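/- Let A be a finite dimensional H-module algebra with Kemer index Ind(A) = (α, s) and parameter Par(A) = (d(A), n_A − 1), where d(A) is the dimension of the semisimple part and n_A the nilpotency index of the radical. Then (α, s) ≤ (d(A), n_A − 1) in the lexicographic order. -/

import Mathlib

noncomputable section
open TensorProduct

/-! ## The free `H`-module algebra -/

variable (F : Type) [Field F] (H : Type) [Ring H] [Algebra F H]

/-- The free `H`-module algebra `F^H⟨X⟩` on a set of variables `V`:
the tensor algebra on `F X ⊗ H`. -/
abbrev FreeHMA (V : Type) : Type := TensorAlgebra F ((V →₀ F) ⊗[F] H)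

variable {V : Type}

/-- The variable `x_v^h`. -/
def xvar (v : V) (h : H) : FreeHMA F H V :=
  TensorAlgebra.ι F (Finsupp.single v 1 ⊗ₜ[F] h)

/-- The algebra endomorphism of the free `H`-module algebra induced by a linear
substitution of the variables (not touching the `H`-labels). -/
def substHom (g : V → (V →₀ F)) : FreeHMA F H V →ₐ[F] FreeHMA F H V :=
  TensorAlgebra.lift F ((TensorAlgebra.ι F).comp
    (LinearMap.rTensor H (Finsupp.linearCombination F g)))

/-- `f|_{x_i ↔ x_j}` : swapping two variables. -/
def swapSubst [DecidableEq V] (i j : V) : FreeHMA F H V →ₐ[F] FreeHMA F H V :=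
  substHom F H (fun v => Finsupp.single (Equiv.swap i j v) 1)

/-- `f|_{x_i → x_j}` : substituting `x_j` for `x_i`. -/
def renameSubst [DecidableEq V] (i j : V) : FreeHMA F H V →ₐ[F] FreeHMA F H V :=
  substHom F H (Function.update (fun v => Finsupp.single v 1) i (Finsupp.single j 1))

/-- `f` is alternating on the set of variables `X`. -/
def AlternatingOn [DecidableEq V] (X : Finset V) (f : FreeHMA F H V) : Prop :=
  ∀ i ∈ X, ∀ j ∈ X, i ≠ j → swapSubst F H i j f = -f

/-- `f` involves only variables from `T`. -/
def DependsOnlyOn (f : FreeHMA F H V) (T : Set V) : Prop :=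
  f ∈ Algebra.adjoin F {x : FreeHMA F H V | ∃ v ∈ T, ∃ h : H, x = xvar F H v h}

/-- `f` is a multilinear `H`-polynomial in the variables of `supp` (and involves no
other variables): substituting `α x_i + y` for `x_i` (`y` a fresh variable) gives
`α f + f|_{x_i → y}`. -/
def MultilinearOn [DecidableEq V] (supp S : Finset V) (f : FreeHMA F H V) : Prop :=
  DependsOnlyOn F H f ↑supp ∧ S ⊆ supp ∧
  ∀ i ∈ S, ∀ y, y ∉ supp → ∀ α : F,
    substHom F H (Function.update (fun v => Finsupp.single v 1) i
        (α • Finsupp.single i 1 + Finsupp.single y 1)) f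
      = α • f + renameSubst F H i y f

/-! ## `H`-module algebras -/

variable [Coalgebra F H]

/-- An `H`-module algebra structure on an `F`-algebra `A`: an `H`-action by linear maps
such that `h·(ab) = (h₍₁₎·a)(h₍₂₎·b)` and `h·1 = ε(h)1`. -/
structure HMA (A : Type) [Ring A] [Algebra F A] where
  act : H →ₗ[F] A →ₗ[F] A
  act_one : act 1 = LinearMap.id
  act_mul : ∀ h k : H, act (h * k) = (act h).comp (act k)
  act_algebraOne : ∀ h : H, act h 1 = (Coalgebra.counit (R := F) h) • (1 : A)
  act_mul_compat :
    (TensorProduct.lift act).comp ((LinearMap.mul' F A).lTensor H)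
      = (LinearMap.mul' F A).comp
          (((TensorProduct.map (TensorProduct.lift act) (TensorProduct.lift act)).comp
            (TensorProduct.tensorTensorTensorComm F H H A A).toLinearMap).comp
            ((Coalgebra.comul (R := F) (A := H)).rTensor (A ⊗[F] A)))

variable {A : Type} [Ring A] [Algebra F A]

/-- Evaluation of `H`-polynomials at an assignment `v : V → A` of the variables,
sending `x_v^h` to `h · (v v)`. -/
def HMA.eval (M : HMA F H A) (v : V → A) : FreeHMA F H V →ₐ[F] A :=
  TensorAlgebra.lift F
    (TensorProduct.lift ((M.act.flip).comp (Finsupp.linearCombination F v)))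

/-- The set of `H`-identities of `A` (in variables `V`). -/
def HMA.idSet (M : HMA F H A) (V : Type) : Set (FreeHMA F H V) :=
  {f | ∀ v : V → A, M.eval F H v f = 0}

/-- The `F`-subspace of `H`-identities of `A`. -/
def HMA.idSub (M : HMA F H A) (V : Type) : Submodule F (FreeHMA F H V) :=
  ⨅ v : V → A, LinearMap.ker (M.eval F H v).toLinearMap

/-! ## `H`-T-ideals -/

/-- The canonical `H`-module algebra structure on the free `H`-module algebra is
characterized by `h · x_v^k = x_v^{hk}` on generators. -/
def IsFreeAction (𝔉 : HMA F H (FreeHMA F H V)) : Prop :=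
  ∀ (h k : H) (p : V →₀ F),
    𝔉.act h (TensorAlgebra.ι F (p ⊗ₜ[F] k)) = TensorAlgebra.ι F (p ⊗ₜ[F] (h * k))

/-- An `H`-T-ideal: a two-sided ideal of the free `H`-module algebra stable under all
`H`-endomorphisms, i.e. under all substitutions of the variables by arbitrary
`H`-polynomials (`𝔉` is the free `H`-action). -/
def IsHTIdeal (𝔉 : HMA F H (FreeHMA F H V)) (Γ : Set (FreeHMA F H V)) : Prop :=
  (0 : FreeHMA F H V) ∈ Γ ∧
  (∀ f g, f ∈ Γ → g ∈ Γ → f + g ∈ Γ) ∧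
  (∀ f g, f ∈ Γ → g * f ∈ Γ ∧ f * g ∈ Γ) ∧
  (∀ (v : V → FreeHMA F H V) f, f ∈ Γ → 𝔉.eval F H v f ∈ Γ)

/-- The `H`-T-ideal generated by a set of `H`-polynomials. -/
def hTIdealSpan (𝔉 : HMA F H (FreeHMA F H V)) (s : Set (FreeHMA F H V)) :
    Set (FreeHMA F H V) :=
  ⋂₀ {Γ | IsHTIdeal F H 𝔉 Γ ∧ s ⊆ Γ}

/-- `Γ` contains the `t`-th Capelli identity: every multilinear `H`-polynomial
alternating in `t` variables belongs to `Γ`. -/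
def SatisfiesCapelli (Γ : Set (FreeHMA F H ℕ)) (t : ℕ) : Prop :=
  ∀ (f : FreeHMA F H ℕ) (supp X : Finset ℕ),
    MultilinearOn F H supp supp f → X ⊆ supp → X.card = t → AlternatingOn F H X f → f ∈ Γ

/-! ## The Kemer index -/

/-- There are, for every `μ`, multilinear `H`-polynomials outside `Γ` alternating on `μ`
disjoint (small) sets of cardinality `a` and on `s` further disjoint (big) sets of
cardinality `a+1`. -/
def HasKemerAlt (Γ : Set (FreeHMA F H ℕ)) (a s : ℕ) : Prop :=
  ∀ μ : ℕ, ∃ (supp : Finset ℕ) (f : FreeHMA F H ℕ)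
      (Xs : Fin μ → Finset ℕ) (Ys : Fin s → Finset ℕ),
    f ∉ Γ ∧ MultilinearOn F H supp supp f ∧
    (∀ i, Xs i ⊆ supp) ∧ (∀ j, Ys j ⊆ supp) ∧
    (∀ i, (Xs i).card = a) ∧ (∀ j, (Ys j).card = a + 1) ∧
    Pairwise (fun i i' => Disjoint (Xs i) (Xs i')) ∧
    Pairwise (fun j j' => Disjoint (Ys j) (Ys j')) ∧
    (∀ i j, Disjoint (Xs i) (Ys j)) ∧
    (∀ i, AlternatingOn F H (Xs i) f) ∧ (∀ j, AlternatingOn F H (Ys j) f)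

/-- `α(Γ)`, the first component of the Kemer index. -/
def kemerAlpha (Γ : Set (FreeHMA F H ℕ)) : ℕ :=
  sSup {a | HasKemerAlt F H Γ a 0}

/-- `s(Γ)`, the second component of the Kemer index. -/
def kemerS (Γ : Set (FreeHMA F H ℕ)) : ℕ :=
  sSup {s | HasKemerAlt F H Γ (kemerAlpha F H Γ) s}

/-- The Kemer index `Ind(Γ) = (α(Γ), s(Γ))`. -/
def kemerIndex (Γ : Set (FreeHMA F H ℕ)) : ℕ × ℕ :=
  (kemerAlpha F H Γ, kemerS F H Γ)

/-- An `H`-Kemer polynomial of `Γ` of rank `μ`. -/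
def IsKemerPoly (Γ : Set (FreeHMA F H ℕ)) (μ : ℕ) (f : FreeHMA F H ℕ) : Prop :=
  ∃ (supp : Finset ℕ) (Xs : Fin μ → Finset ℕ)
      (Ys : Fin (kemerS F H Γ) → Finset ℕ),
    f ∉ Γ ∧ MultilinearOn F H supp supp f ∧
    (∀ i, Xs i ⊆ supp) ∧ (∀ j, Ys j ⊆ supp) ∧
    (∀ i, (Xs i).card = kemerAlpha F H Γ) ∧
    (∀ j, (Ys j).card = kemerAlpha F H Γ + 1) ∧
    Pairwise (fun i i' => Disjoint (Xs i) (Xs i')) ∧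
    Pairwise (fun j j' => Disjoint (Ys j) (Ys j')) ∧
    (∀ i j, Disjoint (Xs i) (Ys j)) ∧
    (∀ i, AlternatingOn F H (Xs i) f) ∧ (∀ j, AlternatingOn F H (Ys j) f)

/-! ## Finite dimensional `H`-module algebras, radicals and parameters -/

/-- A bundled finite dimensional `H`-module algebra. -/
structure FDHMA where
  carrier : Type
  [ring : Ring carrier]
  [alg : Algebra F carrier]
  fd : FiniteDimensional F carrier
  M : HMA F H carrier

attribute [instance] FDHMA.ring FDHMA.alg

/-- The Jacobson radical of an `F`-algebra, as an `F`-subspace. -/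
def jacRad (A : Type) [Ring A] [Algebra F A] : Submodule F A :=
  ((⊥ : Ideal A).jacobson).restrictScalars F

/-- The nilpotency index `n_A` of the Jacobson radical. -/
def nilIndex (A : Type) [Ring A] : ℕ :=
  sInf {n : ℕ | ((⊥ : Ideal A).jacobson) ^ n = ⊥}

/-- `d(A)`, the dimension of the semisimple part `A/J(A)`. -/
def ssDim (A : Type) [Ring A] [Algebra F A] : ℕ :=
  Module.finrank F (A ⧸ jacRad F A)

/-- The parameter `Par(A) = (d(A), n_A - 1)` of a finite dimensional algebra. -/
def par (A : FDHMA F H) : ℕ × ℕ :=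
  (ssDim F A.carrier, nilIndex A.carrier - 1)

/-- The `H`-identities (in countably many variables) of a bundled algebra. -/
def FDHMA.ids (A : FDHMA F H) : Set (FreeHMA F H ℕ) :=
  A.M.idSet F H ℕ

/-- An `H`-basic algebra: not `H`-PI-equivalent to a finite direct product of finite
dimensional `H`-module algebras of strictly smaller parameter. -/
def IsHBasic (A : FDHMA F H) : Prop :=
  ¬ ∃ (s : ℕ) (B : Fin s → FDHMA F H),
      (∀ i, toLex (par F H (B i)) < toLex (par F H A)) ∧
      A.ids F H = ⋂ i, (B i).ids F H

/-- The `H`-ideal of an `H`-module algebra generated by a set. -/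
def hIdealSpan (M : HMA F H A) (s : Set A) : Submodule F A :=
  sInf {I : Submodule F A | s ⊆ I ∧ (∀ a : A, ∀ x ∈ I, a * x ∈ I ∧ x * a ∈ I) ∧
    (∀ h : H, ∀ x ∈ I, M.act h x ∈ I)}

set_option linter.unusedSectionVars false
section HopfPart
open Coalgebra HopfAlgebra
universe u
variable {k : Type u} [Field k] {H : Type u} [Ring H] [HopfAlgebra k H]
variable {M : Type u} [AddCommGroup M] [Module k M]

/-- Sweedler sum. -/
def sw (k : Type u) [Field k] {H : Type u} [Ring H] [HopfAlgebra k H]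
    {M : Type u} [AddCommGroup M] (a : H) (β : H → H → M) : M :=
  ∑ i ∈ (ℛ k a).index, β ((ℛ k a).left i) ((ℛ k a).right i)

/-- Bilinearity. -/
structure Bil (k : Type u) [Field k] {H : Type u} [Ring H] [HopfAlgebra k H]
    {M : Type u} [AddCommGroup M] [Module k M] (β : H → H → M) : Prop where
  l : ∀ y, IsLinearMap k (fun x => β x y)
  r : ∀ x, IsLinearMap k (fun y => β x y)

/-- Trilinearity. -/
structure Tri (k : Type u) [Field k] {H : Type u} [Ring H] [HopfAlgebra k H]
    {M : Type u} [AddCommGroup M] [Module k M] (β : H → H → H → M) : Prop where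
  l : ∀ y z, IsLinearMap k (fun x => β x y z)
  m : ∀ x z, IsLinearMap k (fun y => β x y z)
  r : ∀ x y, IsLinearMap k (fun z => β x y z)

/-- Bundling. -/
def Bil.toL {β : H → H → M} (h : Bil k β) : H →ₗ[k] H →ₗ[k] M :=
  LinearMap.mk₂ k β (fun a b y => (h.l y).map_add a b) (fun c a y => (h.l y).map_smul c a)
    (fun x a b => (h.r x).map_add a b) (fun c x a => (h.r x).map_smul c a)

@[simp] lemma Bil.toL_apply {β : H → H → M} (h : Bil k β) (x y : H) : h.toL x y = β x y := rfl

lemma sw_eq {β : H → H → M} (h : Bil k β) (a : H) :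
    sw k a β = TensorProduct.lift h.toL (comul (R := k) a) := by
  rw [← (ℛ k a).eq]; simp [sw]

lemma sw_add {β : H → H → M} (h : Bil k β) (a b : H) : sw k (a + b) β = sw k a β + sw k b β := by
  simp [sw_eq h]

lemma sw_smul {β : H → H → M} (h : Bil k β) (c : k) (a : H) : sw k (c • a) β = c • sw k a β := by
  simp [sw_eq h]

lemma sw_lin {β : H → H → M} (h : Bil k β) : IsLinearMap k (fun a => sw k a β) :=
  ⟨sw_add h, sw_smul h⟩

lemma sw_one {β : H → H → M} (h : Bil k β) : sw k 1 β = β 1 1 := by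
  simp [sw_eq h, Algebra.TensorProduct.one_def]

lemma sw_fun_add (a : H) (β γ : H → H → M) :
    sw k a (fun x y => β x y + γ x y) = sw k a β + sw k a γ := by
  simp [sw, Finset.sum_add_distrib]

lemma sw_fun_smul (c : k) (a : H) (β : H → H → M) :
    sw k a (fun x y => c • β x y) = c • sw k a β := by
  simp [sw, Finset.smul_sum]

lemma sw_map {N : Type u} [AddCommGroup N] [Module k N] (L : M →ₗ[k] N) (a : H) (β : H → H → M) :
    L (sw k a β) = sw k a (fun x y => L (β x y)) := by
  simp [sw]

lemma sw_mul_left {A : Type u} [Ring A] (c : A) (a : H) (β : H → H → A) :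
    c * sw k a β = sw k a (fun x y => c * β x y) := by
  simp [sw, Finset.mul_sum]

lemma sw_mul_right {A : Type u} [Ring A] (c : A) (a : H) (β : H → H → A) :
    sw k a β * c = sw k a (fun x y => β x y * c) := by
  simp [sw, Finset.sum_mul]

lemma sw_comm (a b : H) (G : H → H → H → H → M) :
    sw k a (fun x y => sw k b (fun u v => G x y u v)) =
    sw k b (fun u v => sw k a (fun x y => G x y u v)) := by
  simp only [sw]; rw [Finset.sum_comm]

lemma sw_assoc {T : H → H → H → M} (h : Tri k T) (a : H) :
    sw k a (fun x y => sw k x (fun u v => T u v y)) =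
    sw k a (fun x y => sw k y (fun u v => T x u v)) := by
  let T' : H →ₗ[k] H →ₗ[k] H →ₗ[k] M := LinearMap.mk₂ k
    (fun x y => (IsLinearMap.mk' _ (h.r x y) : H →ₗ[k] M))
    (fun a b y => by ext z; exact (h.l y z).map_add a b)
    (fun c a y => by ext z; exact (h.l y z).map_smul c a)
    (fun x a b => by ext z; exact (h.m x z).map_add a b)
    (fun c x a => by ext z; exact (h.m x z).map_smul c a)
  let L : H ⊗[k] (H ⊗[k] H) →ₗ[k] M :=
    TensorProduct.lift ((TensorProduct.uncurry (RingHom.id k) H H M).comp T')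
  have hL : ∀ x y z, L (x ⊗ₜ (y ⊗ₜ z)) = T x y z := fun x y z => rfl
  have := congrArg L (sum_tmul_tmul_eq (ℛ k a) (fun i => ℛ k ((ℛ k a).left i))
    (fun i => ℛ k ((ℛ k a).right i)))
  simpa [hL, sw] using this

lemma sw_mul {β : H → H → M} (h : Bil k β) (a b : H) :
    sw k (a * b) β = sw k a (fun x y => sw k b (fun u v => β (x * u) (y * v))) := by
  rw [sw_eq h, Bialgebra.comul_mul, ← (ℛ k a).eq, ← (ℛ k b).eq]
  simp only [Finset.sum_mul_sum, sw, map_sum, Algebra.TensorProduct.tmul_mul_tmul,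
    TensorProduct.lift.tmul, Bil.toL_apply]

lemma sw_counit_left {G : H → M} (h : IsLinearMap k G) (a : H) :
    sw k a (fun x y => counit (R := k) x • G y) = G a := by
  have := congrArg (IsLinearMap.mk' G h) (sum_counit_smul (ℛ k a))
  simpa [sw] using this

lemma sw_counit_right {G : H → M} (h : IsLinearMap k G) (a : H) :
    sw k a (fun x y => counit (R := k) y • G x) = G a := by
  have := congrArg (TensorProduct.lift (LinearMap.lsmul k M).flip)
    (sum_map_tmul_counit_eq (R := k) (IsLinearMap.mk' G h) a (repr := ℛ k a))
  simpa [sw] using this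

lemma sw_S_mul (a : H) : sw k a (fun x y => antipode k x * y) = counit (R := k) a • (1 : H) := by
  simpa [sw] using sum_antipode_mul_eq_smul (ℛ k a)

lemma sw_mul_S (a : H) : sw k a (fun x y => x * antipode k y) = counit (R := k) a • (1 : H) := by
  simpa [sw] using sum_mul_antipode_eq_smul (ℛ k a)

lemma IsLinearMap.ofL (L : H →ₗ[k] M) : IsLinearMap k (fun x => L x) := ⟨L.map_add, L.map_smul⟩

lemma comul_S (a : H) : comul (R := k) (antipode k a) =
    sw k a (fun x y => antipode k y ⊗ₜ[k] antipode k x) := by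
  have bil : Bil k (fun x y : H => antipode k y ⊗ₜ[k] antipode k x) :=
    ⟨fun y => ⟨by simp [TensorProduct.tmul_add], by simp⟩,
     fun y => ⟨by simp [TensorProduct.add_tmul], by simp [TensorProduct.smul_tmul']⟩⟩
  let G : H →ₗ[k] H ⊗[k] H := IsLinearMap.mk' _ (sw_lin bil)
  have hG : ∀ x, G x = sw k x (fun x y => antipode k y ⊗ₜ[k] antipode k x) := fun _ => rfl
  have h1 : WithConv.toConv G * WithConv.toConv (comul (R := k) (A := H)) = 1 := by
    ext h
    rw [(ℛ k h).convMul_apply]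
    change sw k h (fun x y => G x * comul (R := k) y) = _
    have e1 : ∀ x y : H, G x * comul (R := k) y = sw k x (fun u v => sw k y (fun w z =>
        (antipode k v * w) ⊗ₜ[k] (antipode k u * z))) := by
      intro x y
      rw [hG, sw_mul_right]
      congr 1; funext u v
      rw [← (ℛ k y).eq, Finset.mul_sum]
      simp [sw]
    simp only [e1]
    have b0 : ∀ u v : H, Bil k (fun w z : H => (antipode k v * w) ⊗ₜ[k] (antipode k u * z)) :=
      fun u v => ⟨fun y => ⟨by simp [mul_add, TensorProduct.add_tmul], by simp [TensorProduct.smul_tmul']⟩,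
        fun y => ⟨by simp [mul_add, TensorProduct.tmul_add], by simp⟩⟩
    rw [sw_assoc (T := fun u v y => sw k y (fun w z =>
        (antipode k v * w) ⊗ₜ[k] (antipode k u * z)))]
    rotate_left
    · refine ⟨fun v y => ⟨fun a b => ?_, fun c a => ?_⟩, fun u y => ⟨fun a b => ?_, fun c a => ?_⟩,
        fun u v => sw_lin (b0 u v)⟩
      · simp [add_mul, TensorProduct.tmul_add, sw_fun_add]
      · simp [sw_fun_smul]
      · simp [add_mul, TensorProduct.add_tmul, sw_fun_add]
      · simp [← TensorProduct.smul_tmul', sw_fun_smul]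
    have e2 : ∀ x y : H, sw k y (fun u v => sw k v (fun w z =>
        (antipode k u * w) ⊗ₜ[k] (antipode k x * z))) = 1 ⊗ₜ[k] (antipode k x * y) := by
      intro x y
      rw [← sw_assoc (T := fun u w z => (antipode k u * w) ⊗ₜ[k] (antipode k x * z))]
      · have : ∀ p v : H, sw k p (fun u w => (antipode k u * w) ⊗ₜ[k] (antipode k x * v)) =
            counit (R := k) p • (1 ⊗ₜ[k] (antipode k x * v)) := by
          intro p v
          have := congrArg (fun t => t ⊗ₜ[k] (antipode k x * v)) (sw_S_mul (k := k) p)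
          simp only [TensorProduct.smul_tmul'] 
          rw [← this]
          simp [sw, TensorProduct.sum_tmul]
        simp only [this]
        rw [sw_counit_left (G := fun v => 1 ⊗ₜ[k] (antipode k x * v))]
        exact ⟨by simp [mul_add, TensorProduct.tmul_add], by simp⟩
      · refine ⟨fun v y => ⟨fun a b => ?_, fun c a => ?_⟩, fun u y => ⟨fun a b => ?_, fun c a => ?_⟩,
          fun u v => ⟨fun a b => ?_, fun c a => ?_⟩⟩ <;>
        simp [mul_add, add_mul, TensorProduct.tmul_add, TensorProduct.add_tmul, TensorProduct.smul_tmul']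
    simp only [e2]
    have := congrArg (fun t => (1 : H) ⊗ₜ[k] t) (sw_S_mul (k := k) h)
    simp only [sw, TensorProduct.tmul_sum] at this ⊢
    rw [this]
    simp [Algebra.algebraMap_eq_smul_one, Algebra.TensorProduct.one_def]
  have h2 := LinearMap.comul_right_inv (R := k) (C := H)
  have h3 := left_inv_eq_right_inv h1 h2
  have h4 : G = comul ∘ₗ antipode k := congrArg WithConv.ofConv h3
  rw [← hG, h4]; rfl

lemma sw_S {β : H → H → M} (h : Bil k β) (a : H) :
    sw k (antipode k a) β = sw k a (fun x y => β (antipode k y) (antipode k x)) := by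
  rw [sw_eq h, comul_S, sw_map]; simp

end HopfPart


section HopfPart
open Coalgebra HopfAlgebra
universe u
variable {k : Type u} [Field k] {H : Type u} [Ring H] [HopfAlgebra k H]
variable {M : Type u} [AddCommGroup M] [Module k M]

/-- The square of the antipode. -/
def S2 (k H : Type u) [Field k] [Ring H] [HopfAlgebra k H] : H →ₗ[k] H :=
  (antipode k).comp (antipode k)

lemma S2_apply (x : H) : S2 k H x = antipode k (antipode k x) := rfl

lemma S2_mul (x y : H) : S2 k H (x * y) = S2 k H x * S2 k H y := by
  simp [S2_apply, antipode_mul_antidistrib]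

lemma S2_one : S2 k H 1 = 1 := by
  simp [S2_apply]

lemma sw_S2 {β : H → H → M} (h : Bil k β) (a : H) :
    sw k (S2 k H a) β = sw k a (fun x y => β (S2 k H x) (S2 k H y)) := by
  rw [S2_apply, sw_S h, sw_S]
  · rfl
  · exact ⟨fun y => ⟨fun a b => by simp [(h.r _).map_add], fun c a => by simp [(h.r _).map_smul]⟩,
      fun y => ⟨fun a b => by simp [(h.l _).map_add], fun c a => by simp [(h.l _).map_smul]⟩⟩

lemma sw_S2_mul_S (a : H) : sw k a (fun x y => S2 k H y * antipode k x) =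
    counit (R := k) a • (1 : H) := by
  have := congrArg (antipode k) (sw_mul_S (k := k) a)
  rw [sw_map] at this
  simpa [antipode_mul_antidistrib, S2_apply] using this

lemma bil_smul (q : H →ₗ[k] k) : Bil k (fun x y : H => q x • y) :=
  ⟨fun y => ⟨by simp [add_smul], by simp [mul_smul]⟩, fun y => ⟨by simp, by
    intro c x; simp [smul_comm c]⟩⟩

/-- `z ↦ q(z₁) z₂`. -/
def Cq (q : H →ₗ[k] k) : H →ₗ[k] H := IsLinearMap.mk' _ (sw_lin (bil_smul q))

lemma Cq_apply (q : H →ₗ[k] k) (z : H) : Cq q z = sw k z (fun x y => q x • y) := rfl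

/-- `h ↦ Tr(x ↦ h S²(x))`. -/
def fI (k H : Type u) [Field k] [Ring H] [HopfAlgebra k H] : H →ₗ[k] k :=
  (LinearMap.trace k H).comp ((LinearMap.lcomp k H (S2 k H)).comp (LinearMap.mul k H))

lemma fI_apply (h : H) : fI k H h = LinearMap.trace k H ((LinearMap.mulLeft k h).comp (S2 k H)) := rfl

lemma fI_integral [FiniteDimensional k H] (h : H) :
    sw k h (fun x y => fI k H y • x) = fI k H h • (1 : H) := by
  rw [← sub_eq_zero, ← Module.forall_dual_apply_eq_zero_iff k]
  intro q
  rw [map_sub, sub_eq_zero, sw_map]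
  let b := Module.Free.chooseBasis k H
  let qj : Module.Free.ChooseBasisIndex k H → H →ₗ[k] k :=
    fun j => q.comp (LinearMap.mulRight k (antipode k (b j)))
  have hq : ∀ x u, ∑ j, b.coord j u * q (x * antipode k (b j)) = q (x * antipode k u) := by
    intro x u
    conv_rhs => rw [← b.sum_repr u]
    simp only [map_sum, Finset.mul_sum, map_smul, mul_smul_comm, smul_eq_mul]; rfl
  let Lh := (LinearMap.mulLeft k h).comp (S2 k H)
  have key : sw k h (fun x y => q x • ((LinearMap.mulLeft k y).comp (S2 k H) : H →ₗ[k] H)) =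
      ∑ j, (Cq (qj j)).comp (Lh.comp (Cq (b.coord j))) := by
    ext x0
    have e0 := sw_map (k := k) (LinearMap.applyₗ x0 : (H →ₗ[k] H) →ₗ[k] H) h
      (fun x y => q x • ((LinearMap.mulLeft k y).comp (S2 k H) : H →ₗ[k] H))
    simp only [LinearMap.applyₗ_apply_apply] at e0
    rw [e0]
    simp only [LinearMap.smul_apply, LinearMap.comp_apply, LinearMap.mulLeft_apply,
      LinearMap.sum_apply]
    have e1 : ∀ u v, ∑ j, b.coord j u • Cq (qj j) (Lh v) =
        sw k h (fun x y => sw k v (fun a b => q (x * S2 k H a * antipode k u) • (y * S2 k H b))) := by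
      intro u v
      have bil2 : Bil k (fun x y : H => q (x * antipode k u) • y) :=
        bil_smul (q.comp (LinearMap.mulRight k (antipode k u)))
      have : ∑ j, b.coord j u • Cq (qj j) (Lh v) = sw k (Lh v) (fun x y => q (x * antipode k u) • y) := by
        have e : (fun x y : H => q (x * antipode k u) • y) = fun x y =>
            (∑ j, b.coord j u * q (x * antipode k (b j))) • y := by funext x y; rw [hq]
        rw [e]
        simp only [Cq_apply, sw, Finset.smul_sum, Finset.sum_smul]
        rw [Finset.sum_comm]
        simp [qj, mul_smul]
      rw [this]
      change sw k (h * S2 k H v) _ = _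
      rw [sw_mul bil2]
      congr 1; funext x y
      rw [sw_S2]
      exact ⟨fun y => ⟨by intro a b; simp [mul_add, add_mul, add_smul], by intro c a; simp [mul_smul]⟩,
        fun y => ⟨by intro a b; simp [mul_add], by intro c a; simp [smul_comm c]⟩⟩
    have e2 : ∑ j, Cq (qj j) (Lh (Cq (b.coord j) x0)) =
        sw k x0 (fun u v => ∑ j, b.coord j u • Cq (qj j) (Lh v)) := by
      simp only [Cq_apply (b.coord _)]
      simp only [sw, map_sum]
      rw [Finset.sum_comm]
      simp
    rw [e2]
    simp only [e1]
    rw [sw_comm]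
    congr 1; funext x y
    rw [← sw_assoc (T := fun u a b => q (x * S2 k H a * antipode k u) • (y * S2 k H b))]
    · have : ∀ p v : H, sw k p (fun u a => q (x * S2 k H a * antipode k u) • (y * S2 k H v)) =
          counit (R := k) p • (q x • (y * S2 k H v)) := by
        intro p v
        have := congrArg (fun t => q (x * t) • (y * S2 k H v)) (sw_S2_mul_S (k := k) p)
        simp only [sw_mul_left, sw_map] at this
        simp only [sw, Finset.sum_smul] at this ⊢
        simpa [mul_assoc, mul_smul] using this
      simp only [this]
      rw [sw_counit_left (G := fun v => q x • (y * S2 k H v))]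
      exact ⟨by simp [mul_add], by intro c a; simp [smul_comm c]⟩
    · refine ⟨fun v y => ⟨fun a b => ?_, fun c a => ?_⟩, fun u y => ⟨fun a b => ?_, fun c a => ?_⟩,
          fun u v => ⟨fun a b => ?_, fun c a => ?_⟩⟩ <;>
        simp [mul_add, add_mul, add_smul, mul_smul] <;> rw [smul_comm]
  have key2 : ∑ j, (Cq (b.coord j)).comp (Cq (qj j)) = q 1 • LinearMap.id := by
    ext z
    simp only [LinearMap.sum_apply, LinearMap.comp_apply, LinearMap.smul_apply, LinearMap.id_apply]
    have : ∑ j, Cq (b.coord j) (Cq (qj j) z) =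
        sw k z (fun x y => sw k y (fun u v => q (x * antipode k u) • v)) := by
      have e : ∀ x : H, (fun u y : H => q (x * antipode k u) • y) = fun u y =>
          (∑ j, b.coord j u * q (x * antipode k (b j))) • y := by intro x; funext u y; rw [hq]
      simp only [Cq_apply (qj _), sw_map, e]
      simp only [Cq_apply, sw, map_smul, Finset.smul_sum, Finset.sum_smul]
      rw [Finset.sum_comm]
      congr 1; funext i
      rw [Finset.sum_comm]
      simp [qj, smul_smul, mul_comm]
    rw [this]
    rw [← sw_assoc (T := fun x u v => q (x * antipode k u) • v)]
    · have : ∀ p v : H, sw k p (fun x u => q (x * antipode k u) • v) =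
          counit (R := k) p • (q 1 • v) := by
        intro p v
        have := congrArg (fun t => q t • v) (sw_mul_S (k := k) p)
        simp only [sw_map] at this
        simp only [sw, Finset.sum_smul] at this ⊢
        simpa [mul_smul] using this
      simp only [this]
      rw [sw_counit_left (G := fun v => q 1 • v)]
      exact ⟨by simp, by intro c a; simp [smul_comm c]⟩
    · refine ⟨fun v y => ⟨fun a b => ?_, fun c a => ?_⟩, fun u y => ⟨fun a b => ?_, fun c a => ?_⟩,
          fun u v => ⟨fun a b => ?_, fun c a => ?_⟩⟩ <;>
        first
          | (simp [mul_add, add_mul, add_smul, mul_smul]; done)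
          | exact smul_comm _ _ _
          | (simp [mul_add, add_mul, add_smul, mul_smul]; rw [smul_comm])
  have e3 := congrArg (LinearMap.trace k H) key
  rw [sw_map] at e3
  have e4 : ∑ j, LinearMap.trace k H ((Cq (qj j)).comp (Lh.comp (Cq (b.coord j)))) =
      q 1 * fI k H h := by
    have : ∀ j, LinearMap.trace k H ((Cq (qj j)).comp (Lh.comp (Cq (b.coord j)))) =
        LinearMap.trace k H (Lh.comp ((Cq (b.coord j)).comp (Cq (qj j)))) := by
      intro j
      rw [LinearMap.trace_comp_comm', LinearMap.comp_assoc]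
    simp only [this]
    rw [← map_sum, show ∑ j, Lh.comp ((Cq (b.coord j)).comp (Cq (qj j))) =
      Lh.comp (∑ j, (Cq (b.coord j)).comp (Cq (qj j))) by ext; simp, key2]
    rw [LinearMap.comp_smul, LinearMap.comp_id, map_smul, smul_eq_mul]; rfl
  rw [map_sum, e4] at e3
  simp only [map_smul, smul_eq_mul, ← fI_apply] at e3 ⊢
  rw [mul_comm (fI k H h), ← e3]
  simp only [mul_comm]

end HopfPart


set_option linter.unusedSectionVars false
section HopfPart
open Coalgebra HopfAlgebra
universe u
variable {k : Type u} [Field k] {H : Type u} [Ring H] [HopfAlgebra k H]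
variable {M N : Type u} [AddCommGroup M] [Module k M] [AddCommGroup N] [Module k N]

lemma lin_id : IsLinearMap k (fun x : M => x) := ⟨fun _ _ => rfl, fun _ _ => rfl⟩
lemma lin_map {P : Type u} [AddCommGroup P] [Module k P] (L : M →ₗ[k] N) {g : P → M}
    (h : IsLinearMap k g) : IsLinearMap k (fun x => L (g x)) :=
  ⟨fun a b => by rw [h.map_add, map_add], fun c a => by rw [h.map_smul, map_smul]⟩
lemma lin_mulL (c : H) {g : M → H} (h : IsLinearMap k g) : IsLinearMap k (fun x => c * g x) :=
  ⟨fun a b => by rw [h.map_add, mul_add], fun d a => by rw [h.map_smul, mul_smul_comm]⟩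
lemma lin_mulR (c : H) {g : M → H} (h : IsLinearMap k g) : IsLinearMap k (fun x => g x * c) :=
  ⟨fun a b => by rw [h.map_add, add_mul], fun d a => by rw [h.map_smul, smul_mul_assoc]⟩
lemma lin_smulL (c : N) {g : M → k} (h : IsLinearMap k g) : IsLinearMap k (fun x => g x • c) :=
  ⟨fun a b => by rw [h.map_add, add_smul], fun d a => by rw [h.map_smul, smul_assoc]⟩
lemma lin_smulR (c : k) {g : M → N} (h : IsLinearMap k g) : IsLinearMap k (fun x => c • g x) :=
  ⟨fun a b => by rw [h.map_add, smul_add], fun d a => by rw [h.map_smul, smul_comm]⟩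
lemma lin_swf (a : H) {g : M → H → H → N} (h : ∀ x y, IsLinearMap k (fun t => g t x y)) :
    IsLinearMap k (fun t => sw k a (g t)) :=
  ⟨fun s t => by simp [sw, (h _ _).map_add, Finset.sum_add_distrib],
   fun c t => by simp [sw, (h _ _).map_smul, Finset.smul_sum]⟩
lemma lin_sw {β : H → H → N} (hb : Bil k β) {g : M → H} (h : IsLinearMap k g) :
    IsLinearMap k (fun t => sw k (g t) β) :=
  ⟨fun s t => by rw [h.map_add, sw_add hb], fun s t => by rw [h.map_smul, sw_smul hb]⟩
lemma Bil.mk' {β : H → H → M} (l : ∀ y, IsLinearMap k (fun x => β x y))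
    (r : ∀ x, IsLinearMap k (fun y => β x y)) : Bil k β := ⟨l, r⟩
lemma Tri.mk' {β : H → H → H → M} (l : ∀ y z, IsLinearMap k (fun x => β x y z))
    (m : ∀ x z, IsLinearMap k (fun y => β x y z))
    (r : ∀ x y, IsLinearMap k (fun z => β x y z)) : Tri k β := ⟨l, m, r⟩
lemma lin_tmL {P : Type u} [AddCommGroup P] [Module k P] (c : N) {g : P → M}
    (h : IsLinearMap k g) : IsLinearMap k (fun x => g x ⊗ₜ[k] c) :=
  ⟨fun a b => by rw [h.map_add, TensorProduct.add_tmul],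
   fun d a => by rw [h.map_smul, TensorProduct.smul_tmul']⟩
lemma lin_tmR {P : Type u} [AddCommGroup P] [Module k P] (c : N) {g : P → M}
    (h : IsLinearMap k g) : IsLinearMap k (fun x => c ⊗ₜ[k] g x) :=
  ⟨fun a b => by rw [h.map_add, TensorProduct.tmul_add],
   fun d a => by rw [h.map_smul, TensorProduct.tmul_smul]⟩

/-- A two-sided normalized integral. -/
structure IsInt (k : Type u) [Field k] {H : Type u} [Ring H] [HopfAlgebra k H] (Λ : H) : Prop where
  l : ∀ h, h * Λ = counit (R := k) h • Λ
  r : ∀ h, Λ * h = counit (R := k) h • Λ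
  one : counit (R := k) Λ = 1

lemma exists_isInt [IsSemisimpleRing H] : ∃ Λ : H, IsInt k Λ := by
  let I : Ideal H := RingHom.ker (Bialgebra.counitAlgHom k H)
  obtain ⟨C, hC⟩ := exists_isCompl I
  have h1 : (1 : H) ∈ I ⊔ C := by rw [hC.sup_eq_top]; trivial
  obtain ⟨i, hi, Λ, hΛ, hs⟩ := Submodule.mem_sup.1 h1
  have hI : ∀ x, x ∈ I ↔ counit (R := k) x = 0 := fun x => Iff.rfl
  have e1 : counit (R := k) Λ = 1 := by
    have := congrArg (counit (R := k)) hs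
    rw [map_add, (hI i).1 hi, zero_add] at this
    simpa using this
  have dis : ∀ x, x ∈ I → x ∈ C → x = 0 := fun x hx hx' => by
    have := hC.inf_eq_bot.le ⟨hx, hx'⟩
    simpa using this
  have hl : ∀ h, h * Λ = counit (R := k) h • Λ := by
    intro h
    rw [← sub_eq_zero]
    apply dis
    · rw [hI]; simp [e1]
    · apply sub_mem (C.mul_mem_left _ hΛ)
      rw [Algebra.smul_def]; exact C.mul_mem_left _ hΛ
  refine ⟨Λ, hl, ?_, e1⟩
  intro a
  rw [← sub_eq_zero]
  set y := Λ * a - counit (R := k) a • Λ with hy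
  have ey : counit (R := k) y = 0 := by simp [hy, e1]
  have yl : ∀ h, h * y = counit (R := k) h • y := by
    intro h
    rw [hy, mul_sub, ← mul_assoc, hl, smul_sub, mul_smul_comm, hl, smul_mul_assoc,
      smul_comm (counit (R := k) a)]
  obtain ⟨D, hD⟩ := exists_isCompl (Ideal.span {y} : Ideal H)
  have h1 : (1 : H) ∈ (Ideal.span {y} : Ideal H) ⊔ D := by rw [hD.sup_eq_top]; trivial
  obtain ⟨z, hz, d, hd, hs⟩ := Submodule.mem_sup.1 h1
  obtain ⟨c, rfl⟩ := Ideal.mem_span_singleton'.1 hz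
  have : y = y * d := by
    conv_lhs => rw [← mul_one y, ← hs, mul_add, yl c, mul_smul_comm, yl y, ey]
    simp
  have := hD.inf_eq_bot.le ⟨Ideal.mem_span_singleton_self y, this ▸ D.mul_mem_left _ hd⟩
  simpa using this

lemma fI_int [FiniteDimensional k H] {Λ : H} (hΛ : IsInt k Λ) : fI k H Λ = 1 := by
  rw [fI_apply]
  have : (LinearMap.mulLeft k Λ).comp (S2 k H) = (counit (R := k) (A := H)).smulRight Λ := by
    ext x; simp [hΛ.r, S2_apply]
  rw [this, LinearMap.trace_smulRight, hΛ.one]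

/-- Left integral on `H`. -/
def LI (l : H →ₗ[k] k) : Prop := ∀ h, sw k h (fun x y => l y • x) = l h • (1 : H)
/-- Right integral on `H`. -/
def RI (l : H →ₗ[k] k) : Prop := ∀ h, sw k h (fun x y => l x • y) = l h • (1 : H)

lemma LI.B {f : H →ₗ[k] k} (hf : LI f) (a b : H) :
    sw k b (fun x y => f (a * y) • x) = sw k a (fun u v => f (v * b) • antipode k u) := by
  have e1 : ∀ u v : H, f (v * b) • antipode k u =
      sw k v (fun p q => antipode k u * (p * sw k b (fun x y => f (q * y) • x))) := by
    intro u v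
    have := congrArg (fun t => antipode k u * t) (hf (v * b))
    simp only [mul_smul_comm, mul_one] at this
    rw [← this, sw_mul, sw_mul_left]
    · simp only [sw_mul_left, mul_smul_comm]
    · repeat' (first | intro _ | apply_rules [Bil.mk', lin_id, lin_map, lin_mulL, lin_mulR, lin_smulL, lin_smulR])
  simp only [e1]
  rw [← sw_assoc (T := fun u p q => antipode k u * (p * sw k b (fun x y => f (q * y) • x)))]
  · have : ∀ z q : H, sw k z (fun u p => antipode k u * (p * sw k b (fun x y => f (q * y) • x))) =
      counit (R := k) z • sw k b (fun x y => f (q * y) • x) := by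
      intro z q
      have := congrArg (fun t => t * sw k b (fun x y => f (q * y) • x)) (sw_S_mul (k := k) z)
      simpa only [sw_mul_right, mul_assoc, smul_mul_assoc, one_mul] using this
    simp only [this]
    rw [sw_counit_left (G := fun q => sw k b (fun x y => f (q * y) • x))]
    repeat' (first | intro _ | apply_rules [lin_swf, lin_id, lin_map, lin_mulL, lin_mulR, lin_smulL, lin_smulR])
  · repeat' (first | intro _ | apply_rules [Tri.mk', lin_swf, lin_id, lin_map, lin_mulL, lin_mulR, lin_smulL, lin_smulR])

lemma LI.S_eq {f : H →ₗ[k] k} (hf : LI f) {Λ : H} (hΛ : IsInt k Λ) (a : H) :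
    f Λ • antipode k a = sw k Λ (fun x y => f (a * y) • x) := by
  rw [hf.B]
  simp only [hΛ.l, map_smul, smul_assoc]
  rw [sw_counit_right (G := fun u => f Λ • antipode k u)]
  repeat' (first | intro _ | apply_rules [lin_swf, lin_id, lin_map, lin_mulL, lin_mulR, lin_smulL, lin_smulR])

lemma LI.id_eq {f : H →ₗ[k] k} (hf : LI f) {Λ : H} (hΛ : IsInt k Λ) (b : H) :
    f Λ • b = sw k Λ (fun u v => f (v * b) • antipode k u) := by
  rw [← hf.B]
  simp only [hΛ.r, map_smul, smul_assoc]
  rw [sw_counit_right (G := fun u => f Λ • u)]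
  repeat' (first | intro _ | apply_rules [lin_swf, lin_id, lin_map, lin_mulL, lin_mulR, lin_smulL, lin_smulR])

lemma LI.C {f : H →ₗ[k] k} (hf : LI f) {Λ : H} (hΛ : IsInt k Λ) (a : H) :
    f Λ • a = sw k Λ (fun x y => f (y * antipode k a) • x) := by
  have e1 : sw k Λ (fun x y => f (y * antipode k a) • x) =
      sw k a (fun p q => sw k (Λ * p) (fun x y => f (y * antipode k q) • x)) := by
    have : ∀ p q : H, sw k (Λ * p) (fun x y => f (y * antipode k q) • x) =
        counit (R := k) p • sw k Λ (fun x y => f (y * antipode k q) • x) := by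
      intro p q
      rw [hΛ.r, sw_smul]
      repeat' (first | intro _ | apply_rules [Bil.mk', lin_id, lin_map, lin_mulL, lin_mulR, lin_smulL, lin_smulR])
    simp only [this]
    rw [sw_counit_left (G := fun q => sw k Λ (fun x y => f (y * antipode k q) • x))]
    repeat' (first | intro _ | apply_rules [lin_swf, lin_id, lin_map, lin_mulL, lin_mulR, lin_smulL, lin_smulR])
  rw [e1]
  have e2 : ∀ p q : H, sw k (Λ * p) (fun x y => f (y * antipode k q) • x) =
     sw k Λ (fun x y => sw k p (fun u v => f (y * v * antipode k q) • (x * u))) := by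
    intro p q
    rw [sw_mul]
    repeat' (first | intro _ | apply_rules [Bil.mk', lin_id, lin_map, lin_mulL, lin_mulR, lin_smulL, lin_smulR])
  simp only [e2]
  rw [sw_comm]
  have e3 : ∀ x y : H, sw k a (fun p q => sw k p (fun u v =>
      f (y * v * antipode k q) • (x * u))) = f y • (x * a) := by
    intro x y
    rw [sw_assoc (T := fun u v q => f (y * v * antipode k q) • (x * u))]
    · have : ∀ u w : H, sw k w (fun v q => f (y * v * antipode k q) • (x * u)) =
        counit (R := k) w • (f y • (x * u)) := by
        intro u w
        have := congrArg (fun t => f (y * t) • (x * u)) (sw_mul_S (k := k) w)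
        simp only [sw_mul_left, sw_map] at this
        simp only [sw, Finset.sum_smul] at this ⊢
        simpa [mul_assoc, mul_smul] using this
      simp only [this]
      rw [sw_counit_right (G := fun u => f y • (x * u))]
      repeat' (first | intro _ | apply_rules [lin_swf, lin_id, lin_map, lin_mulL, lin_mulR, lin_smulL, lin_smulR])
    · repeat' (first | intro _ | apply_rules [Tri.mk', lin_swf, lin_id, lin_map, lin_mulL, lin_mulR, lin_smulL, lin_smulR])
  simp only [e3]
  have := congrArg (fun t => t * a) (hf Λ)
  simp only [sw_mul_right, smul_mul_assoc, one_mul] at this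
  exact this.symm

end HopfPart


set_option linter.unusedSectionVars false
section HopfPart
open Coalgebra HopfAlgebra
universe u
variable {k : Type u} [Field k] {H : Type u} [Ring H] [HopfAlgebra k H]
variable {M N : Type u} [AddCommGroup M] [Module k M] [AddCommGroup N] [Module k N]
variable [FiniteDimensional k H] {Λ : H}

lemma fI_LI : LI (fI k H) := fI_integral

lemma fI_nondeg (hΛ : IsInt k Λ) {x : H} (h : ∀ y, fI k H (y * x) = 0) : x = 0 := by
  have := fI_LI.id_eq hΛ x
  rw [fI_int hΛ, one_smul] at this
  rw [this]; simp [h, sw]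

lemma S_surj (hΛ : IsInt k Λ) : Function.Surjective (antipode k (A := H)) := by
  intro b
  have := fI_LI.id_eq hΛ b
  rw [fI_int hΛ, one_smul] at this
  refine ⟨sw k Λ (fun u v => fI k H (v * b) • u), ?_⟩
  rw [sw_map]; simpa using this.symm

lemma S_inj (hΛ : IsInt k Λ) : Function.Injective (antipode k (A := H)) :=
  LinearMap.injective_iff_surjective.2 (S_surj hΛ)

/-- Any functional is of the form `f(w ·)`. -/
lemma fI_repr (hΛ : IsInt k Λ) (g : H →ₗ[k] k) (b : H) :
    g b = fI k H (sw k Λ (fun x y => g (antipode k x) • y) * b) := by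
  have := congrArg g (fI_LI.id_eq hΛ b)
  rw [fI_int hΛ, one_smul, sw_map] at this
  rw [this, sw_mul_right, sw_map]
  simp [mul_comm]

lemma eq_zero_of_sw (hΛ : IsInt k Λ) (g : H →ₗ[k] k)
    (h : sw k Λ (fun x y => g y • x) = 0) (y : H) : g y = 0 := by
  set w := sw k Λ (fun x y => g (antipode k x) • y) with hw
  have e := fI_repr hΛ g
  rw [← hw] at e
  have := fI_LI.S_eq hΛ w
  rw [fI_int hΛ, one_smul] at this
  simp only [← e] at this
  rw [h] at this
  have : w = 0 := S_inj hΛ (by rw [this, map_zero])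
  rw [e, this, zero_mul, map_zero]

lemma nakayama (hΛ : IsInt k Λ) (c y : H) : fI k H (c * y) = fI k H (y * S2 k H c) := by
  have h1 := fI_LI.S_eq hΛ c
  have h2 := fI_LI.C hΛ (antipode k c)
  rw [h1] at h2
  have := eq_zero_of_sw hΛ ((fI k H).comp (LinearMap.mulLeft k c) -
    (fI k H).comp (LinearMap.mulRight k (S2 k H c))) (by
      simp only [LinearMap.sub_apply, LinearMap.comp_apply, LinearMap.mulLeft_apply,
        LinearMap.mulRight_apply, sub_smul, S2_apply]
      rw [← sub_eq_zero] at h2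
      simpa [sw] using h2) y
  simpa [sub_eq_zero] using this

lemma S_int (hΛ : IsInt k Λ) : antipode k Λ = Λ := by
  have h1 := hΛ.l (antipode k Λ)
  rw [counit_antipode, hΛ.one, one_smul] at h1
  obtain ⟨w, hw⟩ := S_surj hΛ Λ
  have hw1 : counit (R := k) w = 1 := by rw [← counit_antipode, hw, hΛ.one]
  have h2 : antipode k (w * Λ) = antipode k Λ * antipode k w := antipode_mul_antidistrib _ _
  rw [hΛ.l, hw1, one_smul, hw, h1] at h2
  exact h2

lemma LI.S (hΛ : IsInt k Λ) {l : H →ₗ[k] k} (hl : LI l) : RI (l.comp (antipode k)) := by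
  intro h
  apply S_inj hΛ
  have := hl (antipode k h)
  rw [sw_S] at this
  · rw [sw_map]; simpa using this
  · repeat' (first | intro _ | apply_rules [Bil.mk', lin_id, lin_map, lin_smulL, lin_smulR])

lemma RI.S (hΛ : IsInt k Λ) {l : H →ₗ[k] k} (hl : RI l) : LI (l.comp (antipode k)) := by
  intro h
  apply S_inj hΛ
  have := hl (antipode k h)
  rw [sw_S] at this
  · rw [sw_map]; simpa using this
  · repeat' (first | intro _ | apply_rules [Bil.mk', lin_id, lin_map, lin_smulL, lin_smulR])

lemma LI.unique (hΛ : IsInt k Λ) {l : H →ₗ[k] k} (hl : LI l) (b : H) : l b = l Λ * fI k H b := by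
  rw [fI_repr hΛ l b]
  have := hl.S hΛ Λ
  simp only [LinearMap.comp_apply, S_int hΛ] at this
  rw [this]; simp

/-- The distinguished group-like element. -/
def cG (Λ : H) : H := Cq (fI k H) Λ

lemma Cq_fI (hΛ : IsInt k Λ) (y : H) : Cq (fI k H) y = fI k H y • cG (k := k) Λ := by
  rw [← sub_eq_zero, ← Module.forall_dual_apply_eq_zero_iff k]
  intro p
  have hl : LI (p.comp (Cq (fI k H))) := by
    intro h
    simp only [LinearMap.comp_apply, Cq_apply]
    simp only [sw_map]
    have e : ∀ x y : H, sw k y (fun u v => p (fI k H u • v)) • x =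
        sw k y (fun u v => p (fI k H u • v) • x) := by
      intro x y; simp [sw, Finset.sum_smul]
    simp only [e]
    rw [← sw_assoc (T := fun x u v => p (fI k H u • v) • x)]
    · have : ∀ z v : H, sw k z (fun x u => p (fI k H u • v) • x) = p (fI k H z • v) • 1 := by
        intro z v
        have := congrArg (fun t => p v • t) (fI_LI (k := k) z)
        simp only [sw, Finset.smul_sum] at this ⊢
        simpa [smul_smul, mul_comm] using this
      simp only [this]
    · repeat' (first | intro _ | apply_rules [Tri.mk', lin_id, lin_map, lin_smulL, lin_smulR])
  have := hl.unique hΛ y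
  rw [map_sub, sub_eq_zero, map_smul, smul_eq_mul, mul_comm]
  exact this

lemma cG_groupLike (hΛ : IsInt k Λ) : IsGroupLikeElem k (cG (k := k) Λ) := by
  constructor
  · rw [cG, Cq_apply, sw_map]
    simp only [map_smul, smul_eq_mul]
    have := sw_counit_right (k := k) (G := fun x => fI k H x) (lin_map _ lin_id) Λ
    rw [fI_int hΛ] at this
    rw [← this]
    simp [mul_comm]
  · have e0 : ∀ y : H, comul (R := k) y = sw k y (fun u v => u ⊗ₜ[k] v) := fun y => by
      rw [sw]; exact (ℛ k y).eq.symm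
    have : ∀ y, comul (R := k) (Cq (fI k H) y) = fI k H y • (cG (k := k) Λ ⊗ₜ[k] cG (k := k) Λ) := by
      intro y
      rw [Cq_apply, sw_map]
      simp only [map_smul]
      simp only [e0]
      have e : ∀ x y : H, fI k H x • sw k y (fun u v => u ⊗ₜ[k] v) =
        sw k y (fun u v => fI k H x • (u ⊗ₜ[k] v)) := fun x y => by
          rw [sw_fun_smul]
      simp only [e]
      rw [← sw_assoc (T := fun x u v => fI k H x • (u ⊗ₜ[k] v))]
      · have : ∀ z v : H, sw k z (fun x u => fI k H x • (u ⊗ₜ[k] v)) =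
            fI k H z • (cG (k := k) Λ ⊗ₜ[k] v) := by
          intro z v
          have := congrArg (fun t => t ⊗ₜ[k] v) (Cq_fI hΛ z)
          simp only [Cq_apply, sw, TensorProduct.sum_tmul, TensorProduct.smul_tmul'] at this ⊢
          exact this
        simp only [this]
        have := congrArg (fun t => cG (k := k) Λ ⊗ₜ[k] t) (Cq_fI hΛ y)
        simp only [Cq_apply, sw, TensorProduct.tmul_sum, TensorProduct.tmul_smul] at this ⊢
        exact this
      · repeat' (first | intro _ | apply_rules [Tri.mk', lin_id, lin_map, lin_smulL, lin_smulR, lin_tmL, lin_tmR])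
    have := this Λ
    rwa [fI_int hΛ, one_smul] at this

lemma sw_groupLike {c : H} (hc : IsGroupLikeElem k c) {β : H → H → M} (h : Bil k β) :
    sw k c β = β c c := by
  rw [sw_eq h, hc.comul_eq_tmul_self]; simp

lemma fI_S_c (hΛ : IsInt k Λ) (y : H) : fI k H (antipode k y * cG (k := k) Λ) = fI k H y := by
  have hc := cG_groupLike hΛ
  set c := cG (k := k) Λ with hcdef
  have hR : RI ((fI k H).comp (LinearMap.mulRight k c)) := by
    intro y
    have h1 := Cq_fI hΛ (y * c)
    rw [Cq_apply, sw_mul (bil_smul _)] at h1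
    have e : ∀ x z : H, sw k c (fun u v => fI k H (x * u) • (z * v)) = fI k H (x * c) • (z * c) := by
      intro x z
      rw [sw_groupLike hc]
      repeat' (first | intro _ | apply_rules [Bil.mk', lin_id, lin_map, lin_smulL, lin_smulR, lin_mulL])
    simp only [e] at h1
    have h2 := congrArg (fun t => t * antipode k c) h1
    simp only [sw_mul_right, smul_mul_assoc, mul_assoc, ← hcdef, hc.mul_antipode_cancel, mul_one] at h2
    simpa using h2
  have := (hR.S hΛ).unique hΛ y
  simp only [LinearMap.comp_apply, S_int hΛ, LinearMap.mulRight_apply, hΛ.r, hc.counit_eq_one,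
    one_smul, fI_int hΛ, one_mul] at this
  exact this

lemma S4_eq (hΛ : IsInt k Λ) (y : H) :
    y = cG (k := k) Λ * S2 k H (S2 k H y) * antipode k (cG (k := k) Λ) := by
  have hc := cG_groupLike hΛ
  have hS := fI_S_c hΛ
  set c := cG (k := k) Λ with hcdef
  have hcs := hc.antipode_antipode
  have m1 := hc.mul_antipode_cancel
  have m2 := hc.antipode_mul_cancel
  set z := c * S2 k H y * antipode k c with hz
  have h1 : ∀ x, fI k H (x * y) = fI k H (x * S2 k H z) := by
    intro x
    rw [← nakayama hΛ z x, ← hS (x * y), ← hS (z * x), antipode_mul_antidistrib,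
      antipode_mul_antidistrib, mul_assoc, nakayama hΛ (antipode k y)]
    congr 1
    rw [hz, antipode_mul_antidistrib, antipode_mul_antidistrib, hcs]
    simp only [S2_apply, mul_assoc, m2, mul_one]
  have h2 : S2 k H z = c * S2 k H (S2 k H y) * antipode k c := by
    rw [hz, S2_mul, S2_mul]; simp only [S2_apply, hcs]
  rw [← h2, ← sub_eq_zero]
  apply fI_nondeg hΛ
  intro x; rw [mul_sub, map_sub, h1, sub_self]

lemma S4_one (hΛ : IsInt k Λ) (h : fI k H 1 ≠ 0) (y : H) : S2 k H (S2 k H y) = y := by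
  have : cG (k := k) Λ = 1 := by
    have h1 := Cq_fI hΛ 1
    rw [Cq_apply, sw_one (bil_smul _)] at h1
    have := sub_eq_zero.2 h1
    rw [← smul_sub, smul_eq_zero, or_iff_right h, sub_eq_zero] at this
    exact this.symm
  have h2 := S4_eq hΛ y
  rw [this] at h2
  simpa using h2.symm

end HopfPart


section CycloPart
universe u

lemma geom_zero {K : Type u} [Field K] {x : K} {N : ℕ} (h : x ^ N = 1) (hx : x ≠ 1) :
    ∑ j ∈ Finset.range N, x ^ j = 0 := by
  have := geom_sum_mul x N
  rw [h, sub_self] at this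
  exact (mul_eq_zero.1 this).resolve_right (sub_ne_zero.2 hx)

lemma trace_pow_of_finite_order {K : Type u} [Field K] [CharZero K] {N : ℕ} (hN : 0 < N) {ζ : K}
    (hζ : IsPrimitiveRoot ζ N) {d : ℕ} (w : Matrix (Fin d) (Fin d) K) (hw : w ^ N = 1) :
    ∃ m : ℕ → ℕ, ∀ r, (w ^ r).trace = ∑ j ∈ Finset.range N, (m j : K) * ζ ^ (j * r) := by
  have hζ0 : ζ ≠ 0 := hζ.ne_zero hN.ne'
  have hN0 : (N : K) ≠ 0 := by exact_mod_cast hN.ne'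
  let g : ℕ → ℕ → Matrix (Fin d) (Fin d) K := fun j l => (ζ⁻¹ ^ j) ^ l • w ^ l
  let e : ℕ → Matrix (Fin d) (Fin d) K := fun j => (N : K)⁻¹ • ∑ l ∈ Finset.range N, g j l
  have hp : ∀ j, (ζ⁻¹ ^ j) ^ N = 1 := fun j => by
    rw [← pow_mul, mul_comm, pow_mul, inv_pow, hζ.pow_eq_one, inv_one, one_pow]
  have h1 : ∀ j, w * e j = ζ ^ j • e j := by
    intro j
    have hs : ∑ l ∈ Finset.range N, g j (l + 1) = ∑ l ∈ Finset.range N, g j l := by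
      have a := Finset.sum_range_succ (g j) N
      have b := Finset.sum_range_succ' (g j) N
      have c : g j N = g j 0 := by simp only [g, hp, hw, pow_zero]
      rw [a, c] at b
      exact (add_right_cancel b).symm
    have : ∀ l, w * g j l = ζ ^ j • g j (l + 1) := by
      intro l
      simp only [g, mul_smul_comm, smul_smul]
      rw [pow_succ' w l, pow_succ' (ζ⁻¹ ^ j) l, ← mul_assoc, ← mul_pow, mul_inv_cancel₀ hζ0, one_pow,
        one_mul]
    simp only [e, mul_smul_comm, Finset.mul_sum, this]
    rw [← Finset.smul_sum, hs, smul_comm]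
  have h2 : ∀ r j, w ^ r * e j = (ζ ^ j) ^ r • e j := by
    intro r j
    induction r with
    | zero => simp
    | succ r ih => rw [pow_succ', mul_assoc, ih, mul_smul_comm, h1, smul_smul, pow_succ]
  have h3 : ∑ j ∈ Finset.range N, e j = 1 := by
    simp only [e, g]
    rw [← Finset.smul_sum, Finset.sum_comm]
    have : ∀ l ∈ Finset.range N, ∑ j ∈ Finset.range N, ((ζ⁻¹ ^ j) ^ l • w ^ l) =
        if l = 0 then (N : K) • 1 else 0 := by
      intro l hl
      rw [← Finset.sum_smul]
      split_ifs with h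
      · subst h; simp
      · have : ∑ j ∈ Finset.range N, (ζ⁻¹ ^ j) ^ l = 0 := by
          have e1 : ∀ j, (ζ⁻¹ ^ j) ^ l = (ζ⁻¹ ^ l) ^ j := fun j => by rw [← pow_mul, ← pow_mul, mul_comm]
          simp only [e1]
          apply geom_zero (hp l)
          intro h'
          rw [inv_pow, inv_eq_one] at h'
          exact hζ.pow_ne_one_of_pos_of_lt h (Finset.mem_range.1 hl) h'
        rw [this, zero_smul]
    rw [Finset.sum_congr rfl this]
    simp [hN, smul_smul, hN0]
  have h4 : ∀ j, e j * e j = e j := by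
    intro j
    have : ∀ l, g j l * e j = e j := by
      intro l
      simp only [g, smul_mul_assoc, h2, smul_smul]
      rw [← mul_pow, ← mul_pow, inv_mul_cancel₀ hζ0]; simp
    conv_lhs => lhs; simp only [e]
    rw [smul_mul_assoc, Finset.sum_mul]
    simp only [this]
    simp only [Finset.sum_const, Finset.card_range, ← Nat.cast_smul_eq_nsmul K, smul_smul,
      inv_mul_cancel₀ hN0, one_smul]
  have h5 : ∀ j, ∃ m : ℕ, (e j).trace = m := by
    intro j
    have hi : IsIdempotentElem (Matrix.toLin' (e j)) := by
      rw [IsIdempotentElem, Module.End.mul_eq_comp, ← Matrix.toLin'_mul, h4]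
    have := (LinearMap.IsIdempotentElem.isProj_range _ hi).trace
    rw [Matrix.trace_toLin'_eq] at this
    exact ⟨_, this⟩
  choose m hm using h5
  refine ⟨m, fun r => ?_⟩
  conv_lhs => rw [← mul_one (w ^ r), ← h3, Finset.mul_sum]
  simp only [h2, Matrix.trace_sum, Matrix.trace_smul, hm, smul_eq_mul, ← pow_mul, mul_comm]

lemma cyclo_pos {K : Type u} [Field K] [CharZero K] {N : ℕ} (hN : 0 < N) {ζ : K}
    (hζ : IsPrimitiveRoot ζ N) {n : ℕ} (m : Fin n → ℕ → ℕ)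
    (h : ∑ i, (∑ j ∈ Finset.range N, (m i j : K) * ζ ^ (j * 1)) *
      (∑ j ∈ Finset.range N, (m i j : K) * ζ ^ (j * (N - 1))) = 0) (i : Fin n) :
    ∑ j ∈ Finset.range N, (m i j : K) * ζ ^ (j * (N - 1)) = 0 := by
  let P : Fin n → ℕ → Polynomial ℚ := fun i r => ∑ j ∈ Finset.range N, Polynomial.C (m i j : ℚ) * Polynomial.X ^ (j * r)
  have hP : ∀ (L : Type u) [Field L] [CharZero L] (z : L) i r, Polynomial.aeval z (P i r) =
      ∑ j ∈ Finset.range N, (m i j : L) * z ^ (j * r) := by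
    intro L _ _ z i r
    simp [P]
  have hP' : ∀ (z : ℂ) i r, Polynomial.aeval z (P i r) =
      ∑ j ∈ Finset.range N, (m i j : ℂ) * z ^ (j * r) := by
    intro z i r
    simp [P]
  let Q : Polynomial ℚ := ∑ i, P i 1 * P i (N - 1)
  set ξ := Complex.exp (2 * Real.pi * Complex.I / N)
  have hξ : IsPrimitiveRoot ξ N := Complex.isPrimitiveRoot_exp N hN.ne'
  have hmin : minpoly ℚ ζ = minpoly ℚ ξ := by
    rw [← Polynomial.cyclotomic_eq_minpoly_rat hζ hN, ← Polynomial.cyclotomic_eq_minpoly_rat hξ hN]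
  have hQ : Polynomial.aeval ζ Q = 0 := by
    simp only [Q, map_sum, map_mul, hP]; exact h
  have hQ' : Polynomial.aeval ξ Q = 0 := by
    have := minpoly.dvd ℚ ζ hQ
    rw [hmin] at this
    obtain ⟨R, hR⟩ := this
    rw [hR, map_mul, minpoly.aeval, zero_mul]
  have hconj : ∀ i, Polynomial.aeval ξ (P i (N - 1)) = (starRingEnd ℂ) (Polynomial.aeval ξ (P i 1)) := by
    intro i
    have hc : (starRingEnd ℂ) ξ = ξ ^ (N - 1) := by
      have hn : ‖ξ‖ = 1 := hξ.norm'_eq_one hN.ne'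
      have h1 : ξ * (starRingEnd ℂ) ξ = 1 := by
        rw [Complex.mul_conj, Complex.normSq_eq_norm_sq, hn]; simp
      have h2 : ξ * ξ ^ (N - 1) = 1 := by
        rw [← pow_succ', Nat.sub_add_cancel hN, hξ.pow_eq_one]
      exact mul_left_cancel₀ (hξ.ne_zero hN.ne') (h1.trans h2.symm)
    rw [hP', hP', map_sum]
    simp only [map_mul, map_pow, hc, map_natCast, ← pow_mul, mul_one, mul_comm]
  have hz : ∀ i, Polynomial.aeval ξ (P i 1) = 0 := by
    simp only [Q, map_sum, map_mul, hconj, Complex.mul_conj] at hQ'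
    have : ∑ i, Complex.normSq (Polynomial.aeval ξ (P i 1)) = 0 := by exact_mod_cast hQ'
    intro i
    have := (Finset.sum_eq_zero_iff_of_nonneg (fun i _ => Complex.normSq_nonneg _)).1 this i (Finset.mem_univ _)
    exact Complex.normSq_eq_zero.1 this
  have : Polynomial.aeval ξ (P i (N - 1)) = 0 := by rw [hconj, hz, map_zero]
  have := minpoly.dvd ℚ ξ this
  rw [← hmin] at this
  obtain ⟨R, hR⟩ := this
  rw [← hP, hR, map_mul, minpoly.aeval, zero_mul]

lemma trace_LR {K : Type u} [Field K] {n : ℕ} {d : Fin n → ℕ}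
    (a b : (i : Fin n) → Matrix (Fin (d i)) (Fin (d i)) K) :
    LinearMap.trace K _ ((LinearMap.mulLeft K a).comp (LinearMap.mulRight K b)) =
      ∑ i, (a i).trace * (b i).trace := by
  rw [LinearMap.trace_eq_matrix_trace K (Pi.basis (fun i => Matrix.stdBasis K (Fin (d i)) (Fin (d i))))]
  rw [Matrix.trace, Fintype.sum_sigma]
  congr 1; funext i
  rw [Fintype.sum_prod_type, Matrix.trace, Matrix.trace, Finset.sum_mul_sum]
  congr 1; funext p; congr 1; funext q
  rw [Matrix.diag_apply, LinearMap.toMatrix_apply]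
  simp [Pi.basis_apply, Matrix.stdBasis_eq_single, Pi.basis_repr]
  have hr : ∀ (x : Matrix (Fin (d i)) (Fin (d i)) K),
      (Matrix.stdBasis K (Fin (d i)) (Fin (d i))).repr x (p, q) = x p q := by
    intro x
    simp [Matrix.stdBasis]
  rw [hr, Matrix.mul_apply, Finset.sum_eq_single p]
  · simp
  · intro r _ hr
    rw [Matrix.single_mul_apply_of_ne _ _ _ _ _ hr, mul_zero]
  · simp

lemma exists_scalar_pow {K : Type u} [Field K] [CharZero K] [IsAlgClosed K] {N : ℕ} (hN : 0 < N)
    {ζ : K} (hζ : IsPrimitiveRoot ζ N) {d : ℕ} (v v' : Matrix (Fin d) (Fin d) K)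
    (h1 : v * v' = 1) (hc : ∀ x, v ^ N * x = x * v ^ N) :
    ∃ m : ℕ → ℕ, ∃ s : K, s ≠ 0 ∧ v.trace = s * ∑ j ∈ Finset.range N, (m j : K) * ζ ^ (j * 1) ∧
      v'.trace = s⁻¹ * ∑ j ∈ Finset.range N, (m j : K) * ζ ^ (j * (N - 1)) := by
  have h2 : v' * v = 1 := mul_eq_one_comm.1 h1
  have : v ^ N ∈ Set.range (Matrix.scalar (Fin d)) :=
    Matrix.mem_range_scalar_iff_commute_single.2 fun i j _ => (hc _).symm
  obtain ⟨t, ht⟩ := this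
  rcases isEmpty_or_nonempty (Fin d) with he | he
  · exact ⟨fun _ => 0, 1, one_ne_zero, by simp [Matrix.trace], by simp [Matrix.trace]⟩
  have ht0 : t ≠ 0 := by
    rintro rfl
    have : v ^ N * v' ^ N = 1 := by
      rw [← Commute.mul_pow (by rw [Commute, SemiconjBy, h1, h2]), h1, one_pow]
    rw [← ht] at this
    simp at this
  obtain ⟨s, hs⟩ := IsAlgClosed.exists_pow_nat_eq t hN
  have hs0 : s ≠ 0 := by rintro rfl; rw [zero_pow hN.ne'] at hs; exact ht0 hs.symm
  have ht' : v ^ N = t • 1 := by rw [← ht]; simp [Matrix.smul_one_eq_diagonal]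
  let w := s⁻¹ • v
  have hw : w ^ N = 1 := by
    simp only [w, smul_pow, ht', smul_smul, inv_pow, hs, inv_mul_cancel₀ ht0, one_smul]
  obtain ⟨m, hm⟩ := trace_pow_of_finite_order hN hζ w hw
  refine ⟨m, s, hs0, ?_, ?_⟩
  · rw [← hm 1]; simp [w, hs0]
  · rw [← hm (N - 1)]
    have : w ^ (N - 1) = s • v' := by
      have e1 : w * w ^ (N - 1) = 1 := by rw [← pow_succ', Nat.sub_add_cancel hN, hw]
      have e2 : (s • v') * w = 1 := by simp [w, h2, hs0]
      calc w ^ (N - 1) = (s • v') * w * w ^ (N - 1) := by rw [e2, one_mul]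
        _ = s • v' := by rw [mul_assoc, e1, mul_one]
    rw [this]; simp [hs0]

end CycloPart


section HopfPart
open Coalgebra HopfAlgebra
universe u
variable {k : Type u} [Field k] {H : Type u} [Ring H] [HopfAlgebra k H] [FiniteDimensional k H]

lemma groupLike_finite_order {c : H} (hc : IsGroupLikeElem k c) : ∃ m : ℕ, 0 < m ∧ c ^ m = 1 := by
  have hli : LinearIndependent k (fun x : {a : H | IsGroupLikeElem k a} => (x : H)) :=
    linearIndepOn_isGroupLikeElem (R := k) (A := H)
  have : Finite {a : H | IsGroupLikeElem k a} := hli.finite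
  have hni : ¬ Function.Injective (fun n : ℕ => (⟨c ^ n, hc.pow⟩ : {a : H | IsGroupLikeElem k a})) :=
    not_injective_infinite_finite _
  have key : ∀ a b : ℕ, a < b → c ^ a = c ^ b → ∃ m : ℕ, 0 < m ∧ c ^ m = 1 := by
    intro a b hab h
    refine ⟨b - a, Nat.sub_pos_of_lt hab, ?_⟩
    obtain ⟨e, rfl⟩ := Nat.exists_eq_add_of_le hab.le
    rw [pow_add] at h
    have hu : IsUnit (c ^ a) := (hc.isUnit).pow a
    rw [Nat.add_sub_cancel_left]
    apply hu.mul_left_cancel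
    rw [← h, mul_one]
  simp only [Function.Injective] at hni
  push Not at hni
  obtain ⟨a, b, h, hab⟩ := hni
  have h' : c ^ a = c ^ b := congrArg Subtype.val h
  rcases lt_or_gt_of_ne hab with h1 | h1
  · exact key a b h1 h'
  · exact key b a h1 h'.symm

lemma pi_trace_nondeg {K : Type u} [Field K] {n : ℕ} {d : Fin n → ℕ}
    (z : (i : Fin n) → Matrix (Fin (d i)) (Fin (d i)) K)
    (h : ∀ y : (i : Fin n) → Matrix (Fin (d i)) (Fin (d i)) K, ∑ i, (y i * z i).trace = 0) :
    z = 0 := by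
  funext i; ext p q
  have := h (Pi.single i (Matrix.single q p 1))
  rw [Finset.sum_eq_single i] at this
  · rw [Pi.single_eq_same] at this
    simpa [Matrix.trace_single_mul] using this
  · intro j _ hj; rw [Pi.single_eq_of_ne hj]; simp
  · simp

lemma pi_functional {K : Type u} [Field K] {n : ℕ} {d : Fin n → ℕ}
    (g : ((i : Fin n) → Matrix (Fin (d i)) (Fin (d i)) K) →ₗ[K] K) :
    ∃ v : (i : Fin n) → Matrix (Fin (d i)) (Fin (d i)) K, ∀ x, g x = ∑ i, (x i * v i).trace := by
  refine ⟨fun i => Matrix.of fun p q => g (Pi.single i (Matrix.single q p 1)), ?_⟩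
  set v : (i : Fin n) → Matrix (Fin (d i)) (Fin (d i)) K :=
    fun i => Matrix.of fun p q => g (Pi.single i (Matrix.single q p 1)) with hv
  let τ : ((i : Fin n) → Matrix (Fin (d i)) (Fin (d i)) K) →ₗ[K] K :=
    ∑ i, (Matrix.traceLinearMap _ K K).comp ((LinearMap.mulRight K (v i)).comp (LinearMap.proj i))
  have hτ : ∀ x, τ x = ∑ i, (x i * v i).trace := by intro x; simp [τ]
  intro x
  rw [← hτ]
  congr 1
  refine (Pi.basis (fun i => Matrix.stdBasis K (Fin (d i)) (Fin (d i)))).ext ?_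
  rintro ⟨i, p, q⟩
  rw [hτ, Pi.basis_apply, Matrix.stdBasis_eq_single, Finset.sum_eq_single i]
  · rw [Pi.single_eq_same]
    simp [Matrix.trace_single_mul, hv]
  · intro j _ hj; rw [Pi.single_eq_of_ne hj]; simp
  · simp

lemma fI_one_ne [CharZero k] [IsAlgClosed k] [IsSemisimpleRing H] : fI k H 1 ≠ 0 := by
  obtain ⟨Λ, hΛ⟩ := exists_isInt (k := k) (H := H)
  obtain ⟨n, d, -, ⟨φ⟩⟩ := IsSemisimpleRing.exists_algEquiv_pi_matrix_of_isAlgClosed k H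
  obtain ⟨v, hv⟩ := pi_functional ((fI k H).comp φ.symm.toLinearMap)
  replace hv : ∀ X : H, fI k H X = ∑ i, ((φ X) i * v i).trace := by
    intro X; have := hv (φ X); simpa using this
  have hinj : Function.Injective (LinearMap.mulRight k v) := by
    rw [← LinearMap.ker_eq_bot, LinearMap.ker_eq_bot']
    intro x hx
    rw [LinearMap.mulRight_apply] at hx
    have : φ.symm x = 0 := by
      apply fI_nondeg hΛ
      intro y
      rw [hv]
      apply Finset.sum_eq_zero
      intro i _
      have := congrFun hx i
      rw [Pi.mul_apply] at this
      rw [map_mul, AlgEquiv.apply_symm_apply, Pi.mul_apply, mul_assoc, this]; simp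
    simpa using this
  obtain ⟨u, hu⟩ := (LinearMap.injective_iff_surjective.1 hinj) 1
  rw [LinearMap.mulRight_apply] at hu
  have hu' : v * u = 1 := by
    funext i
    exact mul_eq_one_comm.1 (congrFun hu i)
  have hσ : ∀ X, φ (S2 k H X) * v = v * φ X := by
    intro X
    rw [← sub_eq_zero]
    apply pi_trace_nondeg
    intro y
    have h1 := nakayama hΛ X (φ.symm y)
    rw [hv, hv, ← sub_eq_zero, ← Finset.sum_sub_distrib] at h1
    rw [← neg_eq_zero, ← h1, ← Finset.sum_neg_distrib]
    congr 1; funext i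
    simp only [map_mul, AlgEquiv.apply_symm_apply, Pi.mul_apply, Pi.sub_apply, mul_sub, Matrix.trace_sub]
    rw [neg_sub, ← mul_assoc, Matrix.trace_mul_comm (y i * v i), ← mul_assoc, ← mul_assoc]
  have hσ' : ∀ X, φ (S2 k H X) = v * φ X * u := by
    intro X
    rw [← hσ, mul_assoc, hu', mul_one]
  have hf : ∀ X, fI k H X = ∑ i, ((φ X) i * v i).trace * (u i).trace := by
    intro X
    rw [fI_apply, ← LinearMap.trace_conj' _ φ.toLinearEquiv]
    have : φ.toLinearEquiv.conj ((LinearMap.mulLeft k X).comp (S2 k H)) =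
        (LinearMap.mulLeft k (φ X * v)).comp (LinearMap.mulRight k u) := by
      refine LinearMap.ext fun x => ?_
      simp only [LinearEquiv.conj_apply_apply, LinearMap.comp_apply, LinearMap.mulLeft_apply,
        LinearMap.mulRight_apply]
      change φ (X * S2 k H (φ.symm x)) = _
      rw [map_mul, hσ', AlgEquiv.apply_symm_apply]
      simp only [mul_assoc]
    rw [this, trace_LR]; rfl
  -- central power
  set c := cG (k := k) Λ with hcdef
  have hc : IsGroupLikeElem k c := cG_groupLike hΛ
  obtain ⟨m, hm0, hm⟩ := groupLike_finite_order hc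
  set c' := φ c with hc'
  have hcm : c' ^ m = 1 := by rw [hc', ← map_pow, hm, map_one]
  have hz : ∀ x, (c' * (v * v)) * x = x * (c' * (v * v)) := by
    intro x
    have h1 := congrArg φ (S4_eq hΛ (φ.symm x))
    rw [← hcdef, map_mul, map_mul, hσ', hσ', AlgEquiv.apply_symm_apply, ← hc'] at h1
    have e1 : φ (antipode k c) * c' = 1 := by rw [hc', ← map_mul, hc.antipode_mul_cancel, map_one]
    have h2 := congrArg (fun t => t * (c' * (v * v))) h1
    beta_reduce at h2
    rw [h2]
    calc c' * (v * v) * x = c' * (v * v) * x * (u * (u * v) * v) := by rw [hu, mul_one, hu, mul_one]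
      _ = c' * (v * (v * x * u) * u) * (φ (antipode k c) * c') * (v * v) := by
        rw [e1]; simp only [mul_assoc, mul_one, one_mul]
      _ = _ := by simp only [mul_assoc]
  set z := c' * (v * v) with hzdef
  have hcvu : Commute u v := by rw [Commute, SemiconjBy, hu, hu']
  have huv : (u * u) * (v * v) = 1 := by
    rw [mul_assoc, ← mul_assoc u v v, hu, one_mul, hu]
  have hvu : (v * v) * (u * u) = 1 := by
    rw [mul_assoc, ← mul_assoc v u u, hu', one_mul, hu']
  have hcz : c' = z * (u * u) := by rw [hzdef, mul_assoc, hvu, mul_one]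
  have hzm : z ^ m = v ^ (2 * m) := by
    have h1 : z ^ m * (u * u) ^ m = 1 := by
      rw [← Commute.mul_pow (hz _), ← hcz, hcm]
    have h2 : (u * u) ^ m * (v * v) ^ m = 1 := by
      rw [← Commute.mul_pow (by rw [Commute, SemiconjBy, huv, hvu]), huv, one_pow]
    calc z ^ m = z ^ m * ((u * u) ^ m * (v * v) ^ m) := by rw [h2, mul_one]
      _ = v ^ (2 * m) := by rw [← mul_assoc, h1, one_mul, pow_mul, pow_two]
  have hN : 0 < 2 * m := by omega
  have hcent : ∀ x, v ^ (2 * m) * x = x * v ^ (2 * m) := by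
    intro x; rw [← hzm]; exact (Commute.pow_left (hz x) m)
  have : NeZero (2 * m) := ⟨hN.ne'⟩
  obtain ⟨ζ, hζ⟩ := HasEnoughRootsOfUnity.exists_primitiveRoot k (2 * m)
  have hblock : ∀ i, ∃ m' : ℕ → ℕ, ∃ s : k, s ≠ 0 ∧
      (v i).trace = s * ∑ j ∈ Finset.range (2 * m), (m' j : k) * ζ ^ (j * 1) ∧
      (u i).trace = s⁻¹ * ∑ j ∈ Finset.range (2 * m), (m' j : k) * ζ ^ (j * (2 * m - 1)) := by
    intro i
    refine exists_scalar_pow hN hζ (v i) (u i) (congrFun hu' i) ?_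
    intro x
    have := congrFun (hcent (Pi.single i x)) i
    simpa using this
  choose m' s hs hvt hut using hblock
  intro h0
  have hsum : ∑ i, (∑ j ∈ Finset.range (2 * m), (m' i j : k) * ζ ^ (j * 1)) *
      (∑ j ∈ Finset.range (2 * m), (m' i j : k) * ζ ^ (j * (2 * m - 1))) = 0 := by
    rw [hf] at h0
    rw [← h0]
    congr 1; funext i
    rw [map_one, Pi.one_apply, one_mul, hvt, hut]
    field_simp [hs i]
  have hzero := cyclo_pos hN hζ m' hsum
  have : fI k H Λ = 0 := by
    rw [hf]
    apply Finset.sum_eq_zero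
    intro i _
    rw [hut, hzero]; simp
  rw [fI_int hΛ] at this
  exact one_ne_zero this

end HopfPart


set_option linter.unusedSectionVars false
section HopfPart
open Coalgebra HopfAlgebra
universe u
variable {k : Type u} [Field k] {H : Type u} [Ring H] [HopfAlgebra k H] [FiniteDimensional k H]
variable {Λ : H}

lemma idem_trace_nat {V : Type u} [AddCommGroup V] [Module k V] [FiniteDimensional k V]
    (e : V →ₗ[k] V) (he : e * e = e) : ∃ m : ℕ, LinearMap.trace k V e = m := by
  have hi : IsIdempotentElem e := he
  exact ⟨_, (LinearMap.IsIdempotentElem.isProj_range _ hi).trace⟩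

/-- `G_p(x) = S²(x₁) p(x₂)`. -/
def Gp (p : H →ₗ[k] k) : H →ₗ[k] H :=
  IsLinearMap.mk' (fun a => sw k a (fun x y => p y • S2 k H x)) (by
    repeat' (first | intro _ | apply_rules [lin_sw, Bil.mk', lin_id, lin_map, lin_smulL, lin_smulR]))

lemma Gp_apply (p : H →ₗ[k] k) (a : H) : Gp p a = sw k a (fun x y => p y • S2 k H x) := rfl

lemma Gp_shift (p : H →ₗ[k] k) (h : H) :
    LinearMap.trace k H (Gp (p.comp (LinearMap.mulRight k h))) =
      counit (R := k) h * LinearMap.trace k H (Gp p) := by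
  have key : Gp (p.comp (LinearMap.mulRight k h)) = sw k h (fun a b =>
      ((LinearMap.mulRight k (antipode k a)).comp (Gp p)).comp (LinearMap.mulRight k b)) := by
    ext x
    have e0 := sw_map (k := k) (LinearMap.applyₗ x : (H →ₗ[k] H) →ₗ[k] H) h
      (fun a b => ((LinearMap.mulRight k (antipode k a)).comp (Gp p)).comp (LinearMap.mulRight k b))
    simp only [LinearMap.applyₗ_apply_apply] at e0
    rw [e0]
    simp only [LinearMap.comp_apply, LinearMap.mulRight_apply, Gp_apply]
    have e1 : ∀ a b : H, sw k (x * b) (fun x y => p y • S2 k H x) * antipode k a =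
        sw k x (fun s t => sw k b (fun u v => p (t * v) • (S2 k H s * (S2 k H u * antipode k a)))) := by
      intro a b
      rw [sw_mul]
      · simp only [sw_mul_right, smul_mul_assoc, S2_mul, mul_assoc]
      · repeat' (first | intro _ | apply_rules [Bil.mk', lin_id, lin_map, lin_smulL, lin_smulR])
    simp only [e1]
    rw [sw_comm]
    congr 1; funext s t
    rw [← sw_assoc (T := fun a u v => p (t * v) • (S2 k H s * (S2 k H u * antipode k a)))]
    · have : ∀ z v : H, sw k z (fun a u => p (t * v) • (S2 k H s * (S2 k H u * antipode k a))) =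
          counit (R := k) z • (p (t * v) • S2 k H s) := by
        intro z v
        have := congrArg (fun r => p (t * v) • (S2 k H s * r)) (sw_S2_mul_S (k := k) z)
        simp only [sw_mul_left, ← sw_fun_smul] at this
        rw [this, mul_smul_comm, mul_one, smul_comm]
      simp only [this]
      rw [sw_counit_left (G := fun v => p (t * v) • S2 k H s)]
      repeat' (first | intro _ | apply_rules [Bil.mk', lin_id, lin_map, lin_smulL, lin_smulR, lin_mulL])
    · repeat' (first | intro _ | apply_rules [Tri.mk', lin_id, lin_map, lin_smulL, lin_smulR, lin_mulL, lin_mulR])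
  rw [key, sw_map]
  have e2 : ∀ a b : H, LinearMap.trace k H (((LinearMap.mulRight k (antipode k a)).comp (Gp p)).comp
      (LinearMap.mulRight k b)) = LinearMap.trace k H ((LinearMap.mulRight k (antipode k a * b)).comp (Gp p)) := by
    intro a b
    rw [LinearMap.trace_comp_comm', ← LinearMap.comp_assoc]
    congr 2
    ext x; simp [mul_assoc]
  simp only [e2]
  let L : H →ₗ[k] k := (LinearMap.trace k H).comp
    ((LinearMap.lcomp k H (Gp p)).comp (LinearMap.mul k H).flip)
  have hL : ∀ x, L x = LinearMap.trace k H ((LinearMap.mulRight k x).comp (Gp p)) := fun x => rfl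
  simp only [← hL]
  rw [← sw_map, sw_S_mul, map_smul, hL, smul_eq_mul]
  congr 2
  ext x; simp

lemma Gp_trace (hΛ : IsInt k Λ) (p : H →ₗ[k] k) :
    LinearMap.trace k H (Gp p) = p Λ * LinearMap.trace k H (S2 k H) := by
  have h1 := Gp_shift p Λ
  rw [hΛ.one, one_mul] at h1
  rw [← h1]
  have : Gp (p.comp (LinearMap.mulRight k Λ)) = p Λ • S2 k H := by
    ext x
    rw [Gp_apply]
    simp only [LinearMap.comp_apply, LinearMap.mulRight_apply, hΛ.l, map_smul, smul_assoc]
    rw [sw_counit_right (G := fun x => p Λ • S2 k H x)]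
    · rfl
    · repeat' (first | intro _ | apply_rules [Bil.mk', lin_id, lin_map, lin_smulL, lin_smulR])
  rw [this, map_smul, smul_eq_mul]

/-- Character of the regular representation. -/
def chiR (k H : Type u) [Field k] [Ring H] [HopfAlgebra k H] : H →ₗ[k] k :=
  (LinearMap.trace k H).comp (LinearMap.mul k H)

lemma chiR_apply (h : H) : chiR k H h = LinearMap.trace k H (LinearMap.mulLeft k h) := rfl

lemma bil_psi : Bil k (fun a x : H => sw k a (fun u v => u ⊗ₜ[k] (v * x))) := by
  repeat' (first | intro _ | apply_rules [Bil.mk', lin_sw, lin_swf, lin_id, lin_tmR, lin_tmL, lin_mulL, lin_mulR])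

lemma bil_psi' : Bil k (fun a x : H => sw k a (fun u v => u ⊗ₜ[k] (antipode k v * x))) := by
  repeat' (first | intro _ | apply_rules [Bil.mk', lin_sw, lin_swf, lin_map, lin_id, lin_tmR, lin_tmL, lin_mulL, lin_mulR])

lemma chiR_conv (h : H) : sw k h (fun x y => chiR k H x * chiR k H y) =
    (Module.finrank k H : k) * chiR k H h := by
  let Ψ : H ⊗[k] H →ₗ[k] H ⊗[k] H := TensorProduct.lift bil_psi.toL
  let Ψ' : H ⊗[k] H →ₗ[k] H ⊗[k] H := TensorProduct.lift bil_psi'.toL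
  have hΨ : ∀ a x, Ψ (a ⊗ₜ x) = sw k a (fun u v => u ⊗ₜ[k] (v * x)) := fun a x => by simp [Ψ]
  have hΨ' : ∀ a x, Ψ' (a ⊗ₜ x) = sw k a (fun u v => u ⊗ₜ[k] (antipode k v * x)) := fun a x => by
    simp [Ψ']
  have h1 : Ψ' * Ψ = 1 := by
    apply TensorProduct.ext'
    intro a x
    rw [Module.End.mul_apply, hΨ, sw_map, Module.End.one_apply]
    simp only [hΨ']
    rw [sw_assoc (T := fun u v w => u ⊗ₜ[k] (antipode k v * (w * x)))]
    · have : ∀ u z : H, sw k z (fun v w => u ⊗ₜ[k] (antipode k v * (w * x))) =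
          counit (R := k) z • (u ⊗ₜ[k] x) := by
        intro u z
        have := congrArg (fun t => u ⊗ₜ[k] (t * x)) (sw_S_mul (k := k) z)
        simp only [sw_mul_right] at this
        simp only [sw, TensorProduct.tmul_sum] at this ⊢
        simpa [mul_assoc] using this
      simp only [this]
      rw [sw_counit_right (G := fun u => u ⊗ₜ[k] x)]
      repeat' (first | intro _ | apply_rules [lin_id, lin_tmL])
    · repeat' (first | intro _ | apply_rules [Tri.mk', lin_map, lin_id, lin_tmR, lin_tmL, lin_mulL, lin_mulR])
  have h2 : Ψ * Ψ' = 1 := mul_eq_one_comm.1 h1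
  let L : H →ₗ[k] H →ₗ[k] H := LinearMap.mul k H
  let D : H ⊗[k] H →ₗ[k] H ⊗[k] H := sw k h (fun x y => TensorProduct.map (L x) (L y))
  have hD : D * Ψ = Ψ * TensorProduct.map (L h) LinearMap.id := by
    apply TensorProduct.ext'
    intro a x
    rw [Module.End.mul_apply, Module.End.mul_apply, TensorProduct.map_tmul, hΨ, LinearMap.id_apply, hΨ,
      sw_map]
    change _ = sw k (h * a) _
    rw [sw_mul, sw_comm]
    · congr 1; funext u v
      have e0 := sw_map (k := k) (LinearMap.applyₗ (u ⊗ₜ[k] (v * x)) :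
        (H ⊗[k] H →ₗ[k] H ⊗[k] H) →ₗ[k] _) h (fun x y => TensorProduct.map (L x) (L y))
      simp only [LinearMap.applyₗ_apply_apply] at e0
      change D _ = _ at e0
      rw [e0]
      simp [L, mul_assoc]
    · repeat' (first | intro _ | apply_rules [Bil.mk', lin_map, lin_id, lin_tmR, lin_tmL, lin_mulL, lin_mulR])
  have h3 : LinearMap.trace k _ D = LinearMap.trace k _ (TensorProduct.map (L h) (LinearMap.id : H →ₗ[k] H)) := by
    have : D = Ψ * TensorProduct.map (L h) LinearMap.id * Ψ' := by
      rw [← hD, mul_assoc, h2, mul_one]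
    rw [this, LinearMap.trace_mul_comm, ← mul_assoc, h1, one_mul]
  rw [LinearMap.trace_tensorProduct', LinearMap.trace_id, sw_map] at h3
  simp only [LinearMap.trace_tensorProduct'] at h3
  rw [mul_comm]
  exact h3

lemma S2_eq_one [CharZero k] (hΛ : IsInt k Λ) (h0 : fI k H 1 ≠ 0) (x : H) : S2 k H x = x := by
  have hTr : LinearMap.trace k H (S2 k H) ≠ 0 := by
    intro h
    apply h0
    rw [fI_apply, ← h]; congr 1; ext x; simp
  let T : H →ₗ[k] H := S2 k H
  have hT2 : T * T = 1 := LinearMap.ext fun x => S4_one hΛ h0 x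
  have hnt : Nontrivial H := by
    by_contra hn
    rw [not_nontrivial_iff_subsingleton] at hn
    apply hTr
    rw [Subsingleton.elim (S2 k H) 0, map_zero]
  set n : ℕ := Module.finrank k H with hn
  have hn0 : (n : k) ≠ 0 := by
    have : 0 < n := Module.finrank_pos
    exact_mod_cast this.ne'
  have hchiS : ∀ y, chiR k H (S2 k H y) = chiR k H y := by
    intro y
    rw [chiR_apply, chiR_apply]
    have : LinearMap.mulLeft k (S2 k H y) = T * (LinearMap.mulLeft k y * T) := by
      ext x
      change S2 k H y * x = S2 k H (y * S2 k H x)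
      rw [S2_mul, S4_one hΛ h0]
    rw [this, LinearMap.trace_mul_comm, mul_assoc, hT2, mul_one]
  have hchiΛ : chiR k H Λ = 1 := by
    rw [chiR_apply]
    have : LinearMap.mulLeft k Λ = (counit (R := k) (A := H)).smulRight Λ := by
      ext x; simp [hΛ.r]
    rw [this, LinearMap.trace_smulRight, hΛ.one]
  let E : H →ₗ[k] H := IsLinearMap.mk' (fun a => sw k a (fun x y => ((n : k)⁻¹ * chiR k H y) • x)) (by
    have : ∀ y, (n : k)⁻¹ * chiR k H y = ((n : k)⁻¹ • chiR k H) y := fun y => rfl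
    simp only [this]
    repeat' (first | intro _ | apply_rules [lin_sw, Bil.mk', lin_id, lin_map, lin_smulL, lin_smulR]))
  have hE : ∀ a, E a = sw k a (fun x y => ((n : k)⁻¹ * chiR k H y) • x) := fun a => rfl
  have hEE : E * E = E := by
    ext a
    rw [Module.End.mul_apply, hE a, sw_map]
    simp only [map_smul]
    simp only [hE, ← sw_fun_smul, smul_smul]
    rw [sw_assoc (T := fun x u v => ((n : k)⁻¹ * chiR k H v * ((n : k)⁻¹ * chiR k H u)) • x)]
    · congr 1; funext x y
      have := congrArg (fun t => ((n : k)⁻¹ * (n : k)⁻¹ * t) • x) (chiR_conv (k := k) y)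
      simp only [sw, Finset.mul_sum, Finset.sum_smul] at this ⊢
      rw [← mul_assoc, mul_assoc, ← mul_assoc, ← hn, mul_assoc (n : k)⁻¹, inv_mul_cancel₀ hn0, mul_one] at this
      rw [← this]
      congr 1; funext i; congr 1; ring
    · have : ∀ u v, (n : k)⁻¹ * chiR k H v * ((n : k)⁻¹ * chiR k H u) =
        ((n : k)⁻¹ * (n : k)⁻¹) • (chiR k H v • chiR k H u) := fun u v => by
          simp only [smul_eq_mul]; ring
      simp only [this]
      repeat' (first | intro _ | apply_rules [Tri.mk', lin_id, lin_map, lin_smulL, lin_smulR])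
  have hTE : T * E = Gp ((n : k)⁻¹ • chiR k H) := by
    ext a
    rw [Module.End.mul_apply, hE a, sw_map, Gp_apply]
    simp only [map_smul]; rfl
  have hET : E * T = T * E := by
    rw [hTE]
    ext a
    rw [Module.End.mul_apply, hE, Gp_apply]
    change sw k (S2 k H a) _ = _
    rw [sw_S2]
    · simp only [hchiS]; rfl
    · have : ∀ y, (n : k)⁻¹ * chiR k H y = ((n : k)⁻¹ • chiR k H) y := fun y => rfl
      simp only [this]
      repeat' (first | intro _ | apply_rules [lin_sw, Bil.mk', lin_id, lin_map, lin_smulL, lin_smulR])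
  have htr : (n : k) * LinearMap.trace k H (T * E) = LinearMap.trace k H T := by
    rw [hTE, Gp_trace hΛ, LinearMap.smul_apply, hchiΛ, smul_eq_mul, mul_one, ← mul_assoc,
      mul_inv_cancel₀ hn0, one_mul]
  let Pp : H →ₗ[k] H := (2 : k)⁻¹ • (1 + T)
  let Pm : H →ₗ[k] H := (2 : k)⁻¹ • (1 - T)
  have h22 : (2 : k)⁻¹ * (2 : k)⁻¹ * 2 = (2 : k)⁻¹ := by norm_num
  have hPp : Pp * Pp = Pp := by
    simp only [Pp, smul_mul_smul_comm]
    have : (1 + T) * (1 + T) = (2 : k) • (1 + T) := by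
      rw [mul_add, add_mul, add_mul, hT2, two_smul]; simp; abel
    rw [this, smul_smul, h22]
  have hPm : Pm * Pm = Pm := by
    simp only [Pm, smul_mul_smul_comm]
    have : (1 - T) * (1 - T) = (2 : k) • (1 - T) := by
      rw [mul_sub, sub_mul, sub_mul, hT2, two_smul]; simp; abel
    rw [this, smul_smul, h22]
  have hPpE : (Pp * E) * (Pp * E) = Pp * E := by
    have : E * Pp = Pp * E := by
      simp only [Pp, mul_smul_comm, smul_mul_assoc, mul_add, add_mul, hET]; simp
    rw [mul_assoc, ← mul_assoc E, this, mul_assoc Pp, hEE, ← mul_assoc, hPp]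
  have hPmE : (Pm * E) * (Pm * E) = Pm * E := by
    have : E * Pm = Pm * E := by
      simp only [Pm, mul_smul_comm, smul_mul_assoc, mul_sub, sub_mul, hET]; simp
    rw [mul_assoc, ← mul_assoc E, this, mul_assoc Pm, hEE, ← mul_assoc, hPm]
  have hT : T = Pp - Pm := by
    simp only [Pp, Pm]
    module
  have h1 : (1 : H →ₗ[k] H) = Pp + Pm := by
    simp only [Pp, Pm]
    module
  obtain ⟨a, ha⟩ := idem_trace_nat _ hPp
  obtain ⟨b, hb⟩ := idem_trace_nat _ hPm
  obtain ⟨p, hp⟩ := idem_trace_nat _ hPpE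
  obtain ⟨q, hq⟩ := idem_trace_nat _ hPmE
  have t1 : (n : k) = a + b := by
    rw [← ha, ← hb, ← map_add, ← h1, LinearMap.trace_one]
  have t2 : LinearMap.trace k H T = a - b := by
    rw [← ha, ← hb, ← map_sub, ← hT]
  have t3 : LinearMap.trace k H (T * E) = p - q := by
    rw [← hp, ← hq, ← map_sub, ← sub_mul, ← hT]
  rw [t2, t3] at htr
  have ha0 : a ≠ 0 := by
    rintro rfl
    have hi : IsIdempotentElem Pp := hPp
    have := (LinearMap.IsIdempotentElem.trace_eq_zero_iff hi).1 (by simpa using ha)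
    have e := congrArg (fun g : H →ₗ[k] H => g 1) this
    simp only [Pp, T, LinearMap.smul_apply, LinearMap.add_apply, Module.End.one_apply, S2_one,
      LinearMap.zero_apply] at e
    rw [← two_smul k (1 : H), smul_smul] at e
    simp at e
  have hne : (a : ℤ) - b ≠ 0 := by
    intro h
    apply hTr
    change LinearMap.trace k H T = 0
    rw [t2]; exact_mod_cast congrArg (Int.cast : ℤ → k) h
  have hz : ((a : ℤ) + b) * ((p : ℤ) - q) = a - b := by
    rw [t1] at htr
    exact_mod_cast htr
  have hb0 : b = 0 := by
    have hpq : (p : ℤ) - q ≠ 0 := by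
      intro h; rw [h, mul_zero] at hz; exact hne hz.symm
    rcases lt_or_gt_of_ne hpq with h | h
    · exfalso
      have : ((a : ℤ) + b) * ((p : ℤ) - q) ≤ ((a : ℤ) + b) * (-1) :=
        mul_le_mul_of_nonneg_left (by omega) (by positivity)
      omega
    · have : ((a : ℤ) + b) * 1 ≤ ((a : ℤ) + b) * ((p : ℤ) - q) :=
        mul_le_mul_of_nonneg_left (by omega) (by positivity)
      omega
  have hi : IsIdempotentElem Pm := hPm
  have hPm0 := (LinearMap.IsIdempotentElem.trace_eq_zero_iff hi).1 (by rw [hb, hb0]; simp)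
  have : T = 1 := by rw [hT, h1, hPm0]; simp
  exact congrArg (fun g : H →ₗ[k] H => g x) this

end HopfPart


set_option linter.unusedSectionVars false
section HopfPart
open Coalgebra HopfAlgebra
universe u
variable {k : Type u} [Field k] {H : Type u} [Ring H] [HopfAlgebra k H]
variable {Λ : H}

lemma casimir_int (hΛ : IsInt k Λ) {M : Type u} [AddCommGroup M] [Module k M]
    (β : H →ₗ[k] H →ₗ[k] M) (h : H) :
    sw k Λ (fun x y => β (h * x) (antipode k y)) = sw k Λ (fun x y => β x (antipode k y * h)) := by
  have e1 : sw k h (fun p q => sw k (p * Λ) (fun x y => β x (antipode k y * q))) =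
      sw k Λ (fun x y => β x (antipode k y * h)) := by
    have : ∀ p q : H, sw k (p * Λ) (fun x y => β x (antipode k y * q)) =
        counit (R := k) p • sw k Λ (fun x y => β x (antipode k y * q)) := by
      intro p q
      rw [hΛ.l, sw_smul]
      exact ⟨fun y => ⟨by simp, by simp⟩, fun x => ⟨by simp [add_mul], by simp⟩⟩
    simp only [this]
    rw [sw_counit_left (G := fun q => sw k Λ (fun x y => β x (antipode k y * q)))]
    exact ⟨fun a b => by simp only [mul_add, map_add, sw_fun_add],
      fun c a => by simp only [mul_smul_comm, map_smul, sw_fun_smul]⟩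
  rw [← e1]
  have e2 : ∀ p q : H, sw k (p * Λ) (fun x y => β x (antipode k y * q)) =
      sw k p (fun u v => sw k Λ (fun x y => β (u * x) (antipode k y * (antipode k v * q)))) := by
    intro p q
    rw [sw_mul]
    · simp only [antipode_mul_antidistrib, mul_assoc]
    · exact ⟨fun y => ⟨by simp, by simp⟩, fun x => ⟨by simp [add_mul], by simp⟩⟩
  simp only [e2]
  rw [sw_assoc (T := fun u v q => sw k Λ (fun x y => β (u * x) (antipode k y * (antipode k v * q))))]
  · have : ∀ u z : H, sw k z (fun v q => sw k Λ (fun x y =>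
        β (u * x) (antipode k y * (antipode k v * q)))) =
        counit (R := k) z • sw k Λ (fun x y => β (u * x) (antipode k y)) := by
      intro u z
      rw [sw_comm, ← sw_fun_smul]
      congr 1; funext x y
      have := congrArg (fun t => β (u * x) (antipode k y * t)) (sw_S_mul (k := k) z)
      simp only [sw_mul_left] at this
      rw [sw_map] at this
      rw [this]; simp
    simp only [this]
    rw [sw_counit_right (G := fun u => sw k Λ (fun x y => β (u * x) (antipode k y)))]
    exact ⟨fun a b => by simp only [add_mul, map_add, LinearMap.add_apply, sw_fun_add],
      fun c a => by simp only [smul_mul_assoc, map_smul, LinearMap.smul_apply, sw_fun_smul]⟩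
  · refine ⟨fun y z => ⟨fun a b => ?_, fun c a => ?_⟩, fun y z => ⟨fun a b => ?_, fun c a => ?_⟩,
      fun y z => ⟨fun a b => ?_, fun c a => ?_⟩⟩ <;>
    simp only [add_mul, mul_add, map_add, LinearMap.add_apply, sw_fun_add, smul_mul_assoc,
      mul_smul_comm, map_smul, LinearMap.smul_apply, sw_fun_smul]

lemma semisimple_of_int (hΛ : IsInt k Λ) : IsSemisimpleRing H := by
  refine (isSemisimpleModule_iff H H).2 ⟨fun N => ?_⟩
  obtain ⟨P0, hP0⟩ := (N.restrictScalars k).subtype.exists_leftInverse_of_injective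
    (LinearMap.ker_eq_bot.2 Subtype.val_injective)
  let P : H →ₗ[k] H := (N.restrictScalars k).subtype.comp P0
  have hP1 : ∀ m, P m ∈ N := fun m => (P0 m).2
  have hP2 : ∀ m ∈ N, P m = m := fun m hm => by
    have := LinearMap.congr_fun hP0 ⟨m, hm⟩
    exact congrArg Subtype.val this
  let b : H → H →ₗ[k] H →ₗ[k] H := fun m =>
    LinearMap.mk₂ k (fun x y => x * P (y * m)) (by simp [add_mul]) (by simp) (by simp [add_mul, mul_add])
      (by simp)
  let Q : H →ₗ[H] H :=
    { toFun := fun m => sw k Λ (fun x y => x * P (antipode k y * m))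
      map_add' := fun a b => by simp only [mul_add, map_add, sw_fun_add]
      map_smul' := fun h m => by
        have := casimir_int hΛ (b m) h
        simp only [b, LinearMap.mk₂_apply, mul_assoc] at this
        simp only [smul_eq_mul, RingHom.id_apply, sw_mul_left]
        exact this.symm }
  have hQ : ∀ m, Q m = sw k Λ (fun x y => x * P (antipode k y * m)) := fun m => rfl
  have hQ1 : ∀ m, Q m ∈ N := fun m => by
    rw [hQ]
    exact N.sum_mem fun i _ => N.smul_mem _ (hP1 _)
  have hQ2 : ∀ m ∈ N, Q m = m := fun m hm => by
    rw [hQ]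
    have : ∀ x y : H, x * P (antipode k y * m) = (x * antipode k y) * m := fun x y => by
      rw [hP2 (antipode k y * m) (N.smul_mem (antipode k y) hm), mul_assoc]
    simp only [this, ← sw_mul_right, sw_mul_S, hΛ.one, one_smul, one_mul]
  refine ⟨LinearMap.ker Q, ?_, ?_⟩
  · rw [Submodule.disjoint_def]
    intro x hx hx'
    rw [← hQ2 x hx]; exact hx'
  · rw [codisjoint_iff, eq_top_iff]
    intro x _
    refine Submodule.mem_sup.2 ⟨Q x, hQ1 x, x - Q x, ?_, by simp⟩
    rw [LinearMap.mem_ker, map_sub, hQ2 _ (hQ1 x), sub_self]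

lemma int_baseChange (K : Type u) [Field K] [Algebra k K] (hΛ : IsInt k Λ) :
    IsInt K ((1 : K) ⊗ₜ[k] Λ) := by
  refine ⟨fun h => ?_, fun h => ?_, ?_⟩
  · induction h with
    | zero => simp
    | add a b ha hb => rw [add_mul, ha, hb, map_add, add_smul]
    | tmul c a =>
      rw [Algebra.TensorProduct.tmul_mul_tmul, hΛ.l, TensorProduct.counit_tmul, mul_one,
        TensorProduct.tmul_smul]
      simp [TensorProduct.smul_tmul']
  · induction h with
    | zero => simp
    | add a b ha hb => rw [mul_add, ha, hb, map_add, add_smul]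
    | tmul c a =>
      rw [Algebra.TensorProduct.tmul_mul_tmul, hΛ.r, TensorProduct.counit_tmul, one_mul,
        TensorProduct.tmul_smul]
      simp [TensorProduct.smul_tmul']
  · rw [TensorProduct.counit_tmul, hΛ.one]; simp

/-- Larson and Radford: the antipode of a semisimple Hopf algebra in characteristic zero is an
involution. -/
theorem antipode_sq [CharZero k] [FiniteDimensional k H] [IsSemisimpleRing H] (x : H) :
    antipode k (antipode k x) = x := by
  obtain ⟨Λ, hΛ⟩ := exists_isInt (k := k) (H := H)
  let K := AlgebraicClosure k
  have hI := int_baseChange K hΛ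
  have : IsSemisimpleRing (K ⊗[k] H) := semisimple_of_int hI
  have : CharZero K := charZero_of_injective_algebraMap (algebraMap k K).injective
  have h1 := S2_eq_one hI (fI_one_ne (k := K) (H := K ⊗[k] H)) ((1 : K) ⊗ₜ[k] x)
  rw [S2_apply, TensorProduct.antipode_def] at h1
  have h2 : (1 : K) ⊗ₜ[k] (antipode k (antipode k x)) = (1 : K) ⊗ₜ[k] x := by
    simpa using h1
  exact Algebra.TensorProduct.includeRight_injective (R := k) (A := K) (B := H)
    (algebraMap k K).injective h2

end HopfPart


section RadPart
open Coalgebra HopfAlgebra Polynomial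

lemma nilp_of_trace {k B : Type} [Field k] [CharZero k] [Ring B] [Algebra k B]
    [FiniteDimensional k B] (a : B)
    (h : ∀ b, LinearMap.trace k B (LinearMap.mulLeft k (a * b)) = 0) : IsNilpotent a := by
  have hintegral : IsIntegral k a := Algebra.IsIntegral.isIntegral a
  obtain ⟨q, hq, hnd⟩ := (minpoly k a).exists_eq_pow_rootMultiplicity_mul_and_not_dvd
    (minpoly.ne_zero hintegral) 0
  set m := (minpoly k a).rootMultiplicity 0
  have hcop : IsCoprime ((X - C 0 : k[X]) ^ (m + 1)) q :=
    IsCoprime.pow_left (((irreducible_X_sub_C (0 : k)).coprime_iff_not_dvd).2 hnd)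
  obtain ⟨u, v, huv⟩ := hcop
  rw [C_0, sub_zero] at *
  have hz : a ^ m * aeval a q = 0 := by
    have := minpoly.aeval k a
    rw [hq] at this
    simpa using this
  have h1 : a * (aeval a u * a ^ m) + aeval a v * aeval a q = 1 := by
    have := congrArg (aeval a) huv
    simp only [map_add, map_mul, map_pow, aeval_X, map_one] at this
    rw [← this]
    congr 1
    have hc : Commute a (aeval a u) := by
      have := (Commute.all (X : k[X]) u).map (aeval a)
      simpa using this
    rw [← mul_assoc, hc.eq, mul_assoc, ← pow_succ']
  set e := a * (aeval a u * a ^ m)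
  have hev : e * (aeval a v * aeval a q) = 0 := by
    have hc : Commute (aeval a v) (aeval a q) := (Commute.all v q).map (aeval a)
    simp only [e]
    rw [hc.eq, mul_assoc, mul_assoc, ← mul_assoc (a ^ m), hz]; simp
  have hee : e * e = e := by
    have := congrArg (e * ·) h1
    simpa [mul_add, hev] using this
  have hidem : IsIdempotentElem (LinearMap.mulLeft k e) := by
    change _ * _ = _
    ext x; simp [← mul_assoc, hee]
  have h0 := (LinearMap.IsIdempotentElem.trace_eq_zero_iff hidem).1 (h _)
  have he0 : e = 0 := by simpa using LinearMap.congr_fun h0 1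
  rw [he0, zero_add] at h1
  refine ⟨m, ?_⟩
  have hc : Commute (aeval a v) (aeval a q) := (Commute.all v q).map (aeval a)
  rw [← mul_one (a ^ m), ← h1, hc.eq, ← mul_assoc, hz, zero_mul]

lemma mem_rad_iff {k B : Type} [Field k] [CharZero k] [Ring B] [Algebra k B]
    [FiniteDimensional k B] {n : ℕ} (hn : ((⊥ : Ideal B).jacobson) ^ n = ⊥) (a : B) :
    a ∈ (⊥ : Ideal B).jacobson ↔
      ∀ b, LinearMap.trace k B (LinearMap.mulLeft k (a * b)) = 0 := by
  constructor
  · intro ha b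
    have hab : a * b ∈ (⊥ : Ideal B).jacobson := Ideal.mul_mem_right _ _ ha
    have hp : (a * b) ^ n = 0 := by
      have := Ideal.pow_mem_pow hab n
      rwa [hn, Ideal.mem_bot] at this
    have : IsNilpotent (LinearMap.mulLeft k (a * b)) := by
      refine ⟨n, ?_⟩
      rw [LinearMap.pow_mulLeft, hp]; ext; simp
    exact (LinearMap.isNilpotent_trace_of_isNilpotent this).eq_zero
  · intro h
    rw [Ideal.mem_jacobson_iff]
    intro y
    have hnil : IsNilpotent (y * a) := by
      apply nilp_of_trace (k := k)
      intro b
      have : LinearMap.mulLeft k (y * a * b) = LinearMap.mulLeft k y * LinearMap.mulLeft k (a * b) := by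
        ext x; simp [mul_assoc]
      rw [this, LinearMap.trace_mul_comm, ← h (b * y)]
      congr 1
      ext x; simp [mul_assoc]
    obtain ⟨w, hw⟩ := hnil.isUnit_one_add
    refine ⟨(↑w⁻¹ : B), ?_⟩
    rw [Ideal.mem_bot, sub_eq_zero, mul_assoc, add_comm]
    have : (↑w⁻¹ : B) * (1 + y * a) = 1 := by rw [← hw, Units.inv_mul]
    rwa [mul_add, mul_one] at this

variable {k H B : Type} [Field k] [Ring H] [HopfAlgebra k H] [Ring B] [Algebra k B]

lemma act_mul_sw (M : HMA k H B) (h : H) (a b : B) :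
    M.act h (a * b) = sw k h (fun x y => M.act x a * M.act y b) := by
  have := LinearMap.congr_fun M.act_mul_compat (h ⊗ₜ[k] (a ⊗ₜ[k] b))
  simp only [LinearMap.comp_apply, LinearMap.lTensor_tmul, LinearMap.rTensor_tmul,
    LinearMap.mul'_apply, TensorProduct.lift.tmul] at this
  rw [this, ← (ℛ k h).eq, TensorProduct.sum_tmul]
  simp [sw]

lemma act_mul_left (M : HMA k H B) (h : H) (a b : B) :
    M.act h a * b = sw k h (fun x y => M.act x (a * M.act (antipode k y) b)) := by
  simp only [act_mul_sw]
  rw [sw_assoc (T := fun x y z => M.act x a * M.act y (M.act (antipode k z) b))]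
  · have : ∀ x w : H, sw k w (fun y z => M.act x a * M.act y (M.act (antipode k z) b)) =
        counit (R := k) w • (M.act x a * b) := by
      intro x w
      let L : H →ₗ[k] B := (LinearMap.mulLeft k (M.act x a)).comp (M.act.flip b)
      have e : ∀ y z : H, M.act x a * M.act y (M.act (antipode k z) b) = L (y * antipode k z) := by
        intro y z
        simp [L, M.act_mul]
      simp only [e]
      rw [← sw_map, sw_mul_S]
      simp [L, M.act_one]
    simp only [this]
    rw [sw_counit_right (G := fun x => M.act x a * b)]
    exact ⟨by simp [add_mul], by simp⟩
  · exact ⟨fun y z => ⟨by simp [add_mul], by simp⟩, fun y z => ⟨by simp [mul_add], by simp⟩,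
      fun y z => ⟨by simp [mul_add], by simp⟩⟩

lemma trace_act [CharZero k] [FiniteDimensional k H] [IsSemisimpleRing H] [FiniteDimensional k B]
    (M : HMA k H B) (h : H) (a : B) :
    LinearMap.trace k B (LinearMap.mulLeft k (M.act h a)) =
      counit (R := k) h * LinearMap.trace k B (LinearMap.mulLeft k a) := by
  have e : LinearMap.mulLeft k (M.act h a) = sw k h (fun x y =>
      M.act x * (LinearMap.mulLeft k a * M.act (antipode k y))) := by
    ext b
    have e0 := sw_map (k := k) (LinearMap.applyₗ b : (B →ₗ[k] B) →ₗ[k] B) h (fun x y =>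
      M.act x * (LinearMap.mulLeft k a * M.act (antipode k y)))
    simp only [LinearMap.applyₗ_apply_apply] at e0
    rw [e0, LinearMap.mulLeft_apply, act_mul_left]
    rfl
  let L : H →ₗ[k] k := (LinearMap.trace k B).comp
    ((LinearMap.mulLeft k (LinearMap.mulLeft k a)).comp M.act)
  have hL : ∀ x, L x = LinearMap.trace k B (LinearMap.mulLeft k a * M.act x) := fun x => rfl
  have e2 : ∀ x y, LinearMap.trace k B (M.act x * (LinearMap.mulLeft k a * M.act (antipode k y))) =
      L (antipode k (antipode k x * y)) := by
    intro x y
    rw [LinearMap.trace_mul_comm, hL, antipode_mul_antidistrib, antipode_sq, M.act_mul, mul_assoc]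
    rfl
  rw [e, sw_map]
  simp only [e2]
  have e3 := sw_map (k := k) (L.comp (antipode k)) h (fun x y => antipode k x * y)
  simp only [LinearMap.comp_apply] at e3
  rw [← e3, sw_S_mul, map_smul, antipode_one, map_smul, hL, M.act_one, smul_eq_mul]
  rfl

lemma rad_stable [CharZero k] [FiniteDimensional k H] [IsSemisimpleRing H] [FiniteDimensional k B]
    (M : HMA k H B) {n : ℕ} (hn : ((⊥ : Ideal B).jacobson) ^ n = ⊥) (h : H) {a : B}
    (ha : a ∈ (⊥ : Ideal B).jacobson) : M.act h a ∈ (⊥ : Ideal B).jacobson := by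
  rw [mem_rad_iff (k := k) hn] at ha ⊢
  intro b
  rw [act_mul_left]
  have e0 := sw_map (k := k) ((LinearMap.trace k B).comp (LinearMap.mul k B)) h
    (fun x y => M.act x (a * M.act (antipode k y) b))
  have e1 : ∀ z, ((LinearMap.trace k B).comp (LinearMap.mul k B)) z =
    LinearMap.trace k B (LinearMap.mulLeft k z) := fun z => rfl
  simp only [e1, trace_act, ha, mul_zero] at e0
  rw [e0]
  simp [sw]

end RadPart


section KemerPart
open Polynomial

variable {k H B : Type} [Field k] [Ring H] [HopfAlgebra k H] [Ring B] [Algebra k B]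

lemma eval_ι (M : HMA k H B) (v : ℕ → B) (p : ℕ →₀ k) (h : H) :
    M.eval k H v (TensorAlgebra.ι k (p ⊗ₜ[k] h)) =
      M.act h (Finsupp.linearCombination k v p) := by
  simp [HMA.eval]

lemma eval_subst (M : HMA k H B) (v : ℕ → B) (g : ℕ → (ℕ →₀ k)) (f : FreeHMA k H ℕ) :
    M.eval k H v (substHom k H g f) =
      M.eval k H (fun i => Finsupp.linearCombination k v (g i)) f := by
  have : (M.eval k H v).comp (substHom k H g) =
      M.eval k H (fun i => Finsupp.linearCombination k v (g i)) := by
    apply TensorAlgebra.hom_ext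
    apply TensorProduct.ext'
    intro p h
    simp only [LinearMap.comp_apply, AlgHom.toLinearMap_apply, AlgHom.comp_apply, substHom,
      TensorAlgebra.lift_ι_apply, LinearMap.rTensor_tmul, eval_ι]
    congr 1
    induction p using Finsupp.induction_linear with
    | zero => simp
    | add a b ha hb => simp [ha, hb]
    | single a b => simp
  exact AlgHom.congr_fun this f

lemma eval_congr (M : HMA k H B) {supp : Finset ℕ} {f : FreeHMA k H ℕ}
    (hf : DependsOnlyOn k H f (supp : Set ℕ)) {v w : ℕ → B} (h : ∀ i ∈ supp, v i = w i) :
    M.eval k H v f = M.eval k H w f := by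
  have hs : Set.EqOn (M.eval k H v) (M.eval k H w)
      {x : FreeHMA k H ℕ | ∃ i ∈ (supp : Set ℕ), ∃ h : H, x = xvar k H i h} := by
    rintro x ⟨i, hi, g, rfl⟩
    simp only [xvar, eval_ι, Finsupp.linearCombination_single, h i hi]
  exact AlgHom.eqOn_adjoin_iff.2 hs hf

lemma eval_lin (M : HMA k H B) {supp : Finset ℕ} {f : FreeHMA k H ℕ}
    (hf : MultilinearOn k H supp supp f) {i : ℕ} (hi : i ∈ supp) (v : ℕ → B) (α : k) (b c : B) :
    M.eval k H (Function.update v i (α • c + b)) f =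
      α • M.eval k H (Function.update v i c) f + M.eval k H (Function.update v i b) f := by
  obtain ⟨y, hy⟩ := Infinite.exists_notMem_finset supp
  have hyi : y ≠ i := fun h => hy (h ▸ hi)
  have h := congrArg (M.eval k H (Function.update (Function.update v i c) y b)) (hf.2.2 i hi y hy α)
  rw [map_add, map_smul, renameSubst, eval_subst, eval_subst] at h
  have aux : ∀ j ∈ supp, j ≠ y := fun j hj e => hy (e ▸ hj)
  refine ((eval_congr M hf.1 ?_).trans h).trans
    (congrArg₂ (fun s t => α • s + t) (eval_congr M hf.1 ?_) (eval_congr M hf.1 ?_))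
  · intro j hj
    rcases eq_or_ne j i with rfl | hji
    · simp [hyi.symm]
    · simp [hji, aux j hj]
  · intro j hj
    simp [aux j hj]
  · intro j hj
    rcases eq_or_ne j i with rfl | hji
    · simp
    · simp [hji, aux j hj]

lemma eval_zero (M : HMA k H B) {supp : Finset ℕ} {f : FreeHMA k H ℕ}
    (hf : MultilinearOn k H supp supp f) {i : ℕ} (hi : i ∈ supp) (v : ℕ → B) :
    M.eval k H (Function.update v i 0) f = 0 := by
  have := eval_lin M hf hi v 1 0 0
  simpa using this

lemma eval_add (M : HMA k H B) {supp : Finset ℕ} {f : FreeHMA k H ℕ}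
    (hf : MultilinearOn k H supp supp f) {i : ℕ} (hi : i ∈ supp) (v : ℕ → B) (b c : B) :
    M.eval k H (Function.update v i (c + b)) f =
      M.eval k H (Function.update v i c) f + M.eval k H (Function.update v i b) f := by
  have := eval_lin M hf hi v 1 b c
  simpa using this

lemma eval_smul (M : HMA k H B) {supp : Finset ℕ} {f : FreeHMA k H ℕ}
    (hf : MultilinearOn k H supp supp f) {i : ℕ} (hi : i ∈ supp) (v : ℕ → B) (α : k) (c : B) :
    M.eval k H (Function.update v i (α • c)) f =
      α • M.eval k H (Function.update v i c) f := by
  have := eval_lin M hf hi v α 0 c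
  rw [eval_zero M hf hi] at this
  simpa using this

lemma eval_alt [CharZero k] (M : HMA k H B) {X : Finset ℕ} {f : FreeHMA k H ℕ}
    (hX : AlternatingOn k H X f) {i j : ℕ} (hi : i ∈ X) (hj : j ∈ X) (hij : i ≠ j) (v : ℕ → B)
    (hv : v i = v j) : M.eval k H v f = 0 := by
  have h := congrArg (M.eval k H v) (hX i hi j hj hij)
  rw [swapSubst, eval_subst, map_neg] at h
  have : (fun l => Finsupp.linearCombination k v (Finsupp.single (Equiv.swap i j l) 1)) = v := by
    funext l
    rw [Finsupp.linearCombination_single, one_smul]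
    rcases eq_or_ne l i with rfl | h1
    · simp [hv]
    rcases eq_or_ne l j with rfl | h2
    · simp [hv]
    rw [Equiv.swap_apply_of_ne_of_ne h1 h2]
  rw [this] at h
  have h2 : (2 : k) • M.eval k H v f = 0 := by
    rw [two_smul]; nth_rewrite 1 [h]; simp
  exact (smul_eq_zero.1 h2).resolve_left two_ne_zero

/-- Scaling the variables in a set `T`. -/
lemma eval_scale (M : HMA k H B) {supp : Finset ℕ} {f : FreeHMA k H ℕ}
    (hf : MultilinearOn k H supp supp f) (v : ℕ → B) (c : k) (T : Finset ℕ) (hT : T ⊆ supp) :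
    M.eval k H (fun j => if j ∈ T then c • v j else v j) f = c ^ T.card • M.eval k H v f := by
  induction T using Finset.induction_on with
  | empty => simp
  | insert a T ha ih =>
    have ih := ih fun x hx => hT (Finset.mem_insert_of_mem hx)
    have ha' : a ∈ supp := hT (Finset.mem_insert_self _ _)
    set w : ℕ → B := fun j => if j ∈ T then c • v j else v j with hw
    have e1 : (fun j => if j ∈ insert a T then c • v j else v j) = Function.update w a (c • w a) := by
      funext j
      rcases eq_or_ne j a with rfl | hja
      · simp [hw, ha]
      · simp [hw, hja]
    rw [e1, eval_smul M hf ha', Function.update_eq_self, ih, Finset.card_insert_of_notMem ha,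
      pow_succ', mul_smul]

/-- The linear map defining the graded evaluation. -/
def gradLin (M : HMA k H B) (v : ℕ → B) (T : Finset ℕ) : (ℕ →₀ k) →ₗ[k] H →ₗ[k] B[X] :=
  Finsupp.linearCombination k (fun j =>
    (((Polynomial.monomial (if j ∈ T then 1 else 0) : B →ₗ[B] B[X]).restrictScalars k).comp
      (M.act.flip (v j))))

/-- The graded evaluation. -/
def gradEval (M : HMA k H B) (v : ℕ → B) (T : Finset ℕ) : FreeHMA k H ℕ →ₐ[k] B[X] :=
  TensorAlgebra.lift k (TensorProduct.lift (gradLin M v T))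

lemma gradEval_coeff (M : HMA k H B) (v : ℕ → B) (T : Finset ℕ) (J : Ideal B) [J.IsTwoSided]
    (hJ : ∀ h : H, ∀ j ∈ T, M.act h (v j) ∈ J) (f : FreeHMA k H ℕ) :
    ∀ n, (gradEval M v T f).coeff n ∈ J ^ n := by
  induction f using TensorAlgebra.induction with
  | algebraMap r =>
    intro n
    rw [AlgHom.commutes, Polynomial.algebraMap_apply, coeff_C]
    split_ifs with h
    · subst h; rw [Submodule.pow_zero, Ideal.one_eq_top]; trivial
    · exact Ideal.zero_mem _
  | ι x =>
    intro n
    rw [gradEval, TensorAlgebra.lift_ι_apply]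
    induction x with
    | zero => simp
    | add a b ha hb => rw [map_add, coeff_add]; exact Ideal.add_mem _ ha hb
    | tmul p h =>
      rw [TensorProduct.lift.tmul, gradLin]
      induction p using Finsupp.induction_linear with
      | zero => simp
      | add a b ha hb =>
        rw [map_add, LinearMap.add_apply, coeff_add]; exact Ideal.add_mem _ ha hb
      | single j c =>
        rw [Finsupp.linearCombination_single, LinearMap.smul_apply, coeff_smul]
        rw [Algebra.smul_def]
        apply Ideal.mul_mem_left
        simp only [LinearMap.comp_apply, LinearMap.restrictScalars_apply, LinearMap.flip_apply,
          coeff_monomial]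
        split_ifs with h1 h2 h3
        · subst h2; rw [Submodule.pow_one]; exact hJ h j h1
        · exact Ideal.zero_mem _
        · subst h3; rw [Submodule.pow_zero, Ideal.one_eq_top]; trivial
        · exact Ideal.zero_mem _
  | mul a b ha hb =>
    intro n
    rw [map_mul, coeff_mul]
    refine Ideal.sum_mem _ fun x hx => ?_
    rw [← Finset.HasAntidiagonal.mem_antidiagonal.1 hx, Ideal.IsTwoSided.pow_add]
    exact Ideal.mul_mem_mul (ha _) (hb _)
  | add a b ha hb =>
    intro n
    rw [map_add, coeff_add]; exact Ideal.add_mem _ (ha n) (hb n)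

lemma gradEval_eval (M : HMA k H B) (v : ℕ → B) (T : Finset ℕ) (c : k) (f : FreeHMA k H ℕ) :
    (gradEval M v T f).sum (fun n b => c ^ n • b) =
      M.eval k H (fun j => if j ∈ T then c • v j else v j) f := by
  have hc : ∀ a : B, Commute (RingHom.id B a) (algebraMap k B c) := fun a =>
    (Algebra.commutes c a).symm
  let ev : B[X] →ₐ[k] B := { eval₂RingHom' (RingHom.id B) (algebraMap k B c) hc with
    commutes' := fun r => by
      change eval₂ _ _ (algebraMap k B[X] r) = _
      rw [Polynomial.algebraMap_apply, eval₂_C]; rfl }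
  have hev : ∀ P : B[X], ev P = P.sum (fun n b => c ^ n • b) := by
    intro P
    change eval₂ (RingHom.id B) (algebraMap k B c) P = _
    rw [eval₂_eq_sum]
    congr 1; funext n b
    rw [Algebra.smul_def, ← map_pow, Algebra.commutes]; rfl
  have : ev.comp (gradEval M v T) = M.eval k H (fun j => if j ∈ T then c • v j else v j) := by
    apply TensorAlgebra.hom_ext
    apply TensorProduct.ext'
    intro p h
    simp only [LinearMap.comp_apply, AlgHom.toLinearMap_apply, AlgHom.comp_apply, gradEval, gradLin,
      TensorAlgebra.lift_ι_apply, TensorProduct.lift.tmul, eval_ι]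
    induction p using Finsupp.induction_linear with
    | zero => simp
    | add a b ha hb => simp only [map_add, LinearMap.add_apply, ha, hb]
    | single j d =>
      simp only [Finsupp.linearCombination_single, LinearMap.smul_apply, map_smul]
      congr 1
      rw [hev]
      simp only [LinearMap.comp_apply, LinearMap.restrictScalars_apply, LinearMap.flip_apply]
      rw [sum_monomial_index _ _ (by simp)]
      split_ifs <;> simp
  rw [← hev, ← this]; rfl

lemma eval_mem_pow [CharZero k] (M : HMA k H B) {supp : Finset ℕ} {f : FreeHMA k H ℕ}
    (hf : MultilinearOn k H supp supp f) (v : ℕ → B) (T : Finset ℕ) (hT : T ⊆ supp)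
    (J : Ideal B) [J.IsTwoSided] (hJ : ∀ h : H, ∀ j ∈ T, M.act h (v j) ∈ J) :
    M.eval k H v f ∈ J ^ T.card := by
  have hco := gradEval_coeff M v T J hJ f T.card
  set P := gradEval M v T f
  have key : P.coeff T.card = M.eval k H v f := by
    rw [← sub_eq_zero, ← Module.forall_dual_apply_eq_zero_iff k]
    intro φ
    rw [map_sub, sub_eq_zero]
    let Q : k[X] := P.sum (fun n b => monomial n (φ b))
    have hQ : Q = monomial T.card (φ (M.eval k H v f)) := by
      apply Polynomial.funext
      intro c
      have e := congrArg φ ((gradEval_eval M v T c f).trans (eval_scale M hf v c T hT))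
      simp only [Polynomial.sum, map_sum, map_smul, smul_eq_mul] at e
      simp only [Q, Polynomial.sum, eval_finsetSum, eval_monomial]
      rw [mul_comm, ← e]
      exact Finset.sum_congr rfl fun _ _ => mul_comm _ _
    have hQc : Q.coeff T.card = φ (P.coeff T.card) := by
      simp only [Q, Polynomial.sum, finsetSum_coeff, coeff_monomial]
      rw [Finset.sum_ite_eq' P.support T.card]
      split_ifs with h
      · rfl
      · rw [notMem_support_iff.1 h, map_zero]
    rw [← hQc, hQ, coeff_monomial, if_pos rfl]
  rwa [← key]

lemma adapted_basis [FiniteDimensional k B] (N : Submodule k B) :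
    ∃ (m : ℕ) (b : Module.Basis (Fin (Module.finrank k (B ⧸ N)) ⊕ Fin m) k B),
      ∀ i, b (Sum.inr i) ∈ N := by
  obtain ⟨C, hC⟩ := Submodule.exists_isCompl N
  have e : Module.finrank k C = Module.finrank k (B ⧸ N) :=
    (Submodule.quotientEquivOfIsCompl N C hC).finrank_eq.symm
  let b1 : Module.Basis (Fin (Module.finrank k (B ⧸ N))) k C :=
    (Module.finBasis k C).reindex (finCongr e)
  let b2 := Module.finBasis k N
  refine ⟨_, (b1.prod b2).map (Submodule.prodEquivOfIsCompl C N hC.symm), fun i => ?_⟩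
  simp [Submodule.coe_prodEquivOfIsCompl']

/-- Core: a multilinear polynomial alternating on many big sets is an identity. -/
lemma alt_is_identity [CharZero k] [FiniteDimensional k H] [IsSemisimpleRing H]
    [FiniteDimensional k B] (M : HMA k H B) {n s : ℕ} (hn : ((⊥ : Ideal B).jacobson) ^ n = ⊥)
    (hs : n ≤ s) {supp : Finset ℕ} {f : FreeHMA k H ℕ} (hf : MultilinearOn k H supp supp f)
    (X : Fin s → Finset ℕ) (hX : ∀ i, X i ⊆ supp) (hc : ∀ i, ssDim k B < (X i).card)
    (hd : Pairwise (fun i j => Disjoint (X i) (X j))) (ha : ∀ i, AlternatingOn k H (X i) f) :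
    f ∈ M.idSet k H ℕ := by
  obtain ⟨m, b, hb⟩ := adapted_basis (jacRad k B)
  have key : ∀ r : ℕ → Fin (Module.finrank k (B ⧸ jacRad k B)) ⊕ Fin m,
      M.eval k H (fun j => b (r j)) f = 0 := by
    intro r
    by_cases h : ∃ i, ∃ x ∈ X i, ∃ y ∈ X i, x ≠ y ∧ r x = r y
    · obtain ⟨i, x, hx, y, hy, hxy, he⟩ := h
      exact eval_alt M (ha i) hx hy hxy _ (by simp only [he])
    · push Not at h
      have ht : ∀ i, ∃ x ∈ X i, ∃ z, r x = Sum.inr z := by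
        intro i
        by_contra hcon
        push Not at hcon
        have hle : (X i).card ≤ (Finset.univ.image (Sum.inl :
            Fin (Module.finrank k (B ⧸ jacRad k B)) → _ ⊕ Fin m)).card := by
          apply Finset.card_le_card_of_injOn r
          · intro x hx
            rcases hr : r x with z | z
            · simp
            · exact absurd hr (hcon x hx z)
          · intro x hx y hy hxy
            by_contra hne
            exact h i x hx y hy hne hxy
        have := Finset.card_image_le (s := Finset.univ) (f := (Sum.inl :
            Fin (Module.finrank k (B ⧸ jacRad k B)) → _ ⊕ Fin m))
        rw [Finset.card_univ, Fintype.card_fin] at this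
        have := hc i
        rw [ssDim] at this
        omega
      choose t ht z hz using ht
      have hinj : Function.Injective t := by
        intro i j hij
        by_contra hne
        exact Finset.disjoint_left.1 (hd hne) (ht i) (hij ▸ ht j)
      have hmem := eval_mem_pow M hf (fun j => b (r j)) (Finset.univ.image t)
        (by
          intro x hx
          obtain ⟨i, -, rfl⟩ := Finset.mem_image.1 hx
          exact hX i (ht i))
        (⊥ : Ideal B).jacobson (by
          intro h x hx
          obtain ⟨i, -, rfl⟩ := Finset.mem_image.1 hx
          rw [hz]
          exact rad_stable M hn h (hb _))
      rw [Finset.card_image_of_injective _ hinj, Finset.card_univ, Fintype.card_fin] at hmem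
      have := Ideal.pow_le_pow_right hs hmem
      rwa [hn, Ideal.mem_bot] at this
  let ext : (supp → B) → ℕ → B := fun w j => if h : j ∈ supp then w ⟨j, h⟩ else 0
  have hext : ∀ (w : supp → B) (i : supp) (x : B),
      ext (Function.update w i x) = Function.update (ext w) i x := by
    intro w i x
    funext j
    rcases eq_or_ne j i with rfl | hji
    · simp [ext]
    · rw [Function.update_of_ne hji]
      simp only [ext]
      split_ifs with h
      · rw [Function.update_of_ne]
        intro e; exact hji (congrArg Subtype.val e)
      · rfl
  let mm : MultilinearMap k (fun _ : supp => B) B := MultilinearMap.mk'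
    (fun w => M.eval k H (ext w) f)
    (fun w i x y => by
      simp only [hext]; exact eval_add M hf i.2 _ _ _)
    (fun w i c x => by
      simp only [hext]; exact eval_smul M hf i.2 _ _ _)
  have hmm : mm = 0 := by
    apply Module.Basis.ext_multilinear (fun _ => b)
    intro r
    by_cases hne : Nonempty (Fin (Module.finrank k (B ⧸ jacRad k B)) ⊕ Fin m)
    · obtain ⟨z0⟩ := hne
      change M.eval k H (ext fun i => b (r i)) f = 0
      rw [← key (fun j => if h : j ∈ supp then r ⟨j, h⟩ else z0)]
      apply eval_congr M hf.1
      intro i hi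
      simp [ext, hi]
    · have : IsEmpty (Fin (Module.finrank k (B ⧸ jacRad k B)) ⊕ Fin m) := not_nonempty_iff.1 hne
      have : Subsingleton B := b.repr.toEquiv.subsingleton
      exact Subsingleton.elim _ _
  intro v
  have h1 : M.eval k H v f = mm (fun i => v i) := by
    change _ = M.eval k H (ext fun i => v i) f
    apply eval_congr M hf.1
    intro i hi
    simp [ext, hi]
  rw [h1, hmm]; rfl

end KemerPart


/-- Let `A` be a finite dimensional `H`-module algebra with Kemer index
`Ind(A) = (α, s)` and parameter `Par(A) = (d(A), n_A - 1)`, where `d(A)` is the dimension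
of the semisimple part `A/J(A)` and `n_A` the nilpotency index of the radical.  Then
`(α, s) ≤ (d(A), n_A - 1)` in the lexicographic order. -/
theorem kemer_index_le_parameter
    (F : Type) [Field F] [CharZero F] (H : Type) [Ring H] [HopfAlgebra F H]
    [FiniteDimensional F H] [IsSemisimpleRing H]
    (A : Type) [Ring A] [Algebra F A] [FiniteDimensional F A] (M : HMA F H A)
    (nA : ℕ) (hnil : ((⊥ : Ideal A).jacobson) ^ nA = ⊥)
    (hmin : ∀ m < nA, ((⊥ : Ideal A).jacobson) ^ m ≠ ⊥) :
    toLex (kemerIndex F H (M.idSet F H ℕ)) ≤ toLex (ssDim F A, nA - 1) := by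
  have hA : ∀ a, HasKemerAlt F H (M.idSet F H ℕ) a 0 → a ≤ ssDim F A := by
    intro a ha
    by_contra hlt
    obtain ⟨supp, f, Xs, _, hf, hml, hX, -, hc, -, hd, -, -, halt, -⟩ := ha nA
    exact hf (alt_is_identity M hnil le_rfl hml Xs hX (fun i => by rw [hc i]; omega) hd halt)
  have hα : kemerAlpha F H (M.idSet F H ℕ) ≤ ssDim F A := csSup_le' fun a ha => hA a ha
  rw [Prod.Lex.toLex_le_toLex]
  rcases hα.lt_or_eq with h | h
  · exact Or.inl h
  · refine Or.inr ⟨h, ?_⟩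
    refine csSup_le' fun s hs => ?_
    have hlt : s < nA := by
      by_contra hge
      obtain ⟨supp, f, _, Ys, hf, hml, -, hY, -, hc, -, hd, -, -, halt⟩ := hs 0
      exact hf (alt_is_identity M hnil (not_lt.1 hge) hml Ys hY
        (fun i => by rw [hc i, h]; omega) hd halt)
    change s ≤ nA - 1
    omega
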